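/- arXiv:2509.06090 — 3 statements merged into one kernel-verified Lean document; each statement's English description precedes it below -/
import Mathlib

section
/- Weighted bilinear bound: let 1 < p, p₁, p₂ < ∞ with 1/p₁ + 1/p₂ = 1/p. Then there is C > 0 such that ‖coth(r)·(a_θ/sinh(r))·ε₁‖_{L^p} ≤ C(1 + ‖ε‖_{L^∞})(‖ε‖_{L^∞} + ‖ε‖_{L^{p₁}})·‖ε₁‖_{L^{p₂}}. -/
/- Weighted bilinear bound for coth(r)·(a_θ/sinh r)·ε₁. -/

open MeasureTheory Set Filter
open scoped ENNReal NNReal Topology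

noncomputable section

/-- Weighted `L^p` norm on the half line: `(∫₀^∞ |F|^p sinh r dr)^{1/p}`. -/
def wLp {E : Type*} [NNNorm E] (p : ℝ) (F : ℝ → E) : ℝ≥0∞ :=
  (∫⁻ r in Set.Ioi (0:ℝ), (‖F r‖₊ : ℝ≥0∞) ^ p * ENNReal.ofReal (Real.sinh r)) ^ (1/p)

/-- Weighted `L^∞` norm on the half line (essential supremum on `(0,∞)`). -/
def wLinf {E : Type*} [NNNorm E] (F : ℝ → E) : ℝ≥0∞ :=
  essSup (fun r => (‖F r‖₊ : ℝ≥0∞)) (volume.restrict (Set.Ioi (0:ℝ)))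

/-- Hyperbolic cotangent. -/
def hcoth (r : ℝ) : ℝ := Real.cosh r / Real.sinh r

/-- The linearized magnetic potential
`a_θ(r) = −∫₀^r Q Re ε sinh − (1/2)∫₀^r |ε|² sinh`. -/
def atheta (Q : ℝ → ℝ) (ε : ℝ → ℂ) (r : ℝ) : ℝ :=
  -(∫ s in Set.Ioc (0:ℝ) r, Q s * (ε s).re * Real.sinh s)
    - (1/2) * ∫ s in Set.Ioc (0:ℝ) r, ‖ε s‖^2 * Real.sinh s

/-- The measure `sinh r dr` on the half line `(0,∞)`. -/
def sinhMeasure : Measure ℝ :=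
  (volume.restrict (Ioi (0:ℝ))).withDensity fun r => ENNReal.ofReal (Real.sinh r)

lemma measurable_ofReal_sinh : Measurable fun r : ℝ => ENNReal.ofReal (Real.sinh r) := by
  fun_prop

instance : SFinite sinhMeasure := by
  unfold sinhMeasure; infer_instance

lemma lintegral_sinhMeasure (h : ℝ → ℝ≥0∞) :
    ∫⁻ r, h r ∂sinhMeasure = ∫⁻ r in Ioi (0:ℝ), h r * ENNReal.ofReal (Real.sinh r) := by
  unfold sinhMeasure
  rw [lintegral_withDensity_eq_lintegral_mul_non_measurable _ measurable_ofReal_sinh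
    (by filter_upwards with r using ENNReal.ofReal_lt_top)]
  exact lintegral_congr fun r => mul_comm _ _

lemma setLIntegral_Iic_sinhMeasure (h : ℝ → ℝ≥0∞) (r : ℝ) :
    ∫⁻ s in Iic r, h s ∂sinhMeasure
      = ∫⁻ s in Ioc 0 r, h s * ENNReal.ofReal (Real.sinh s) := by
  unfold sinhMeasure
  rw [restrict_withDensity measurableSet_Iic, Measure.restrict_restrict measurableSet_Iic,
    lintegral_withDensity_eq_lintegral_mul_non_measurable _ measurable_ofReal_sinh
    (by filter_upwards with r using ENNReal.ofReal_lt_top), inter_comm, Ioi_inter_Iic]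
  exact lintegral_congr fun r => mul_comm _ _

lemma wLp_eq_lintegral_sinhMeasure {E : Type*} [NNNorm E] (p : ℝ) (F : ℝ → E) :
    wLp p F = (∫⁻ r, (‖F r‖₊ : ℝ≥0∞) ^ p ∂sinhMeasure) ^ (1 / p) := by
  rw [lintegral_sinhMeasure, wLp]

lemma exp_div_four_le_sinh {r : ℝ} (hr : 1 ≤ r) : Real.exp r / 4 ≤ Real.sinh r := by
  rw [Real.sinh_eq]
  have h1 : Real.exp (-r) ≤ 1 := Real.exp_le_one_iff.2 (by linarith)
  have h2 : r + 1 ≤ Real.exp r := Real.add_one_le_exp r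
  linarith

lemma lintegral_Iic_ofReal_exp_mul {b : ℝ} (hb : 0 < b) (r : ℝ) :
    ∫⁻ s in Iic r, ENNReal.ofReal (Real.exp (b * s)) = ENNReal.ofReal (Real.exp (b * r) / b) := by
  rw [← ofReal_integral_eq_lintegral_ofReal (integrableOn_exp_mul_Iic hb _)
    (by filter_upwards with s using (Real.exp_pos _).le), integral_exp_mul_Iic hb]

lemma lintegral_Ici_ofReal_exp_neg_mul {b : ℝ} (hb : 0 < b) (s : ℝ) :
    ∫⁻ r in Ici s, ENNReal.ofReal (Real.exp (-b * r)) = ENNReal.ofReal (Real.exp (-b * s) / b) := by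
  have hb' : -b < 0 := by linarith
  rw [setLIntegral_congr Ioi_ae_eq_Ici.symm,
    ← ofReal_integral_eq_lintegral_ofReal (integrableOn_exp_mul_Ioi hb' _)
    (by filter_upwards with s using (Real.exp_pos _).le), integral_exp_mul_Ioi hb']
  congr 1
  rw [neg_div_neg_eq]

/-- Hölder's inequality against exponential weights for the primitive with respect to
`sinh s ds`. -/
lemma rpow_setLIntegral_Iic_sinhMeasure_le {q : ℝ} (hq : 1 < q) {f : ℝ → ℝ≥0∞}
    (hf : Measurable f) (r : ℝ) :
    (∫⁻ s in Iic r, f s ∂sinhMeasure) ^ q ≤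
      (∫⁻ s in Iic r, f s ^ q * ENNReal.ofReal (Real.exp ((q - 1) / 2 * s)) ∂sinhMeasure) *
        ENNReal.ofReal (Real.exp ((q - 1) / 2 * r)) := by
  have hq0 : 0 < q := by linarith
  have hq1 : 0 < q - 1 := by linarith
  have hc := Real.HolderConjugate.conjExponent hq
  set q' := Real.conjExponent q with hq'
  have hq'e : q' = q / (q - 1) := rfl
  set w : ℝ → ℝ≥0∞ := fun s => ENNReal.ofReal (Real.exp ((q - 1) / (2 * q) * s)) with hw
  set v : ℝ → ℝ≥0∞ := fun s => ENNReal.ofReal (Real.exp (-((q - 1) / (2 * q) * s))) with hv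
  have hwv : ∀ s, w s * v s = 1 := fun s => by
    rw [hw, hv, ← ENNReal.ofReal_mul (Real.exp_pos _).le, ← Real.exp_add]
    simp
  have hwm : Measurable w := by fun_prop
  have hvm : Measurable v := by fun_prop
  have key := ENNReal.lintegral_mul_le_Lp_mul_Lq (sinhMeasure.restrict (Iic r)) hc
    (f := fun s => f s * w s) (g := v) (hf.mul hwm).aemeasurable hvm.aemeasurable
  have e1 : ∀ s, ((fun s => f s * w s) * v) s = f s := fun s => by
    simp only [Pi.mul_apply, mul_assoc, hwv, mul_one]
  have e2 : ∀ s, (f s * w s) ^ q = f s ^ q * ENNReal.ofReal (Real.exp ((q - 1) / 2 * s)) :=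
    fun s => by
      rw [ENNReal.mul_rpow_of_nonneg _ _ hq0.le, hw,
        ENNReal.ofReal_rpow_of_pos (Real.exp_pos _), ← Real.exp_mul]
      congr 3
      field_simp
  have e3 : ∀ s, v s ^ q' = ENNReal.ofReal (Real.exp (-(s / 2))) := fun s => by
    rw [hv, ENNReal.ofReal_rpow_of_pos (Real.exp_pos _), ← Real.exp_mul, hq'e]
    congr 2
    field_simp
  simp only [e1, e2, e3] at key
  have hJ : ∫⁻ s in Iic r, ENNReal.ofReal (Real.exp (-(s / 2))) ∂sinhMeasure
      ≤ ENNReal.ofReal (Real.exp (r / 2)) := by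
    rw [setLIntegral_Iic_sinhMeasure]
    calc _ ≤ ∫⁻ s in Ioc 0 r, ENNReal.ofReal (1 / 2) *
            ENNReal.ofReal (Real.exp (1 / 2 * s)) := by
          refine lintegral_mono fun s => ?_
          simp only
          rw [← ENNReal.ofReal_mul (Real.exp_pos _).le, ← ENNReal.ofReal_mul (by norm_num)]
          refine ENNReal.ofReal_le_ofReal ?_
          have h1 : Real.exp (-(s / 2)) * Real.exp s = Real.exp (1 / 2 * s) := by
            rw [← Real.exp_add]; congr 1; ring
          rw [Real.sinh_eq]
          nlinarith [Real.exp_pos (-(s / 2)), Real.exp_pos (-s),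
            mul_pos (Real.exp_pos (-(s / 2))) (Real.exp_pos (-s))]
      _ ≤ ∫⁻ s in Iic r, ENNReal.ofReal (1 / 2) *
            ENNReal.ofReal (Real.exp (1 / 2 * s)) := lintegral_mono_set Ioc_subset_Iic_self
      _ = ENNReal.ofReal (Real.exp (r / 2)) := by
          rw [lintegral_const_mul _ (by fun_prop), lintegral_Iic_ofReal_exp_mul (by norm_num),
            ← ENNReal.ofReal_mul (by norm_num)]
          congr 1
          rw [mul_div_cancel₀ _ (by norm_num)]
          congr 1; ring
  calc (∫⁻ s in Iic r, f s ∂sinhMeasure) ^ q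
      ≤ ((∫⁻ s in Iic r, f s ^ q * ENNReal.ofReal (Real.exp ((q - 1) / 2 * s)) ∂sinhMeasure)
          ^ (1 / q) * (ENNReal.ofReal (Real.exp (r / 2))) ^ (1 / q')) ^ q := by
        refine ENNReal.rpow_le_rpow (key.trans ?_) hq0.le
        gcongr
        exact one_div_nonneg.2 hc.symm.nonneg
    _ = _ := by
        rw [ENNReal.mul_rpow_of_nonneg _ _ hq0.le, ← ENNReal.rpow_mul, ← ENNReal.rpow_mul,
          one_div_mul_cancel hq0.ne', ENNReal.rpow_one,
          ENNReal.ofReal_rpow_of_pos (Real.exp_pos _), ← Real.exp_mul, hq'e]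
        congr 3
        field_simp

/-- Exponential-weight form of Tonelli's theorem on `{s ≤ r}`. -/
lemma lintegral_exp_mul_setLIntegral_Iic_sinhMeasure {a : ℝ} (ha : 0 < a) {h : ℝ → ℝ≥0∞}
    (hh : Measurable h) :
    ∫⁻ r, ENNReal.ofReal (Real.exp (-a * r)) *
        ∫⁻ s in Iic r, h s * ENNReal.ofReal (Real.exp (a * s)) ∂sinhMeasure
      = ENNReal.ofReal (1 / a) * ∫⁻ s, h s ∂sinhMeasure := by
  set K : ℝ → ℝ → ℝ≥0∞ := fun r s =>
    ({x : ℝ × ℝ | x.2 ≤ x.1}.indicator fun x => ENNReal.ofReal (Real.exp (-a * x.1)) *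
      (h x.2 * ENNReal.ofReal (Real.exp (a * x.2)))) (r, s) with hK
  have hKm : Measurable (Function.uncurry K) := by
    refine Measurable.indicator ?_ (measurableSet_le measurable_snd measurable_fst)
    fun_prop
  have h1 : ∀ r, ENNReal.ofReal (Real.exp (-a * r)) *
        ∫⁻ s in Iic r, h s * ENNReal.ofReal (Real.exp (a * s)) ∂sinhMeasure
      = ∫⁻ s, K r s ∂sinhMeasure := fun r => by
    rw [← lintegral_const_mul _ (by fun_prop), ← lintegral_indicator measurableSet_Iic]
    rfl
  have h2 : ∀ s, ∫⁻ r, K r s = ENNReal.ofReal (1 / a) * h s := fun s => by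
    have : ∀ r, K r s = (Ici s).indicator (fun r => ENNReal.ofReal (Real.exp (-a * r)) *
        (h s * ENNReal.ofReal (Real.exp (a * s)))) r := fun r => rfl
    simp only [this]
    rw [lintegral_indicator measurableSet_Ici, lintegral_mul_const _ (by fun_prop),
      lintegral_Ici_ofReal_exp_neg_mul ha, mul_comm (h s), ← mul_assoc,
      ← ENNReal.ofReal_mul (by positivity)]
    congr 2
    rw [div_mul_eq_mul_div, ← Real.exp_add]
    simp
  simp only [h1]
  rw [lintegral_lintegral_swap hKm.aemeasurable]
  simp only [h2]
  rw [lintegral_const_mul _ hh]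

/-- Hardy's inequality on `(1,∞)` for the averages `(sinh r)⁻¹ ∫₀^r f sinh`. -/
lemma exists_hardy_sinhMeasure {q : ℝ} (hq : 1 < q) :
    ∃ C : ℝ≥0∞, C ≠ ⊤ ∧ ∀ f : ℝ → ℝ≥0∞, Measurable f →
      ∫⁻ r in Ioi (1:ℝ), ((∫⁻ s in Iic r, f s ∂sinhMeasure) / ENNReal.ofReal (Real.sinh r)) ^ q *
        ENNReal.ofReal (Real.sinh r) ≤ C * ∫⁻ s, f s ^ q ∂sinhMeasure := by
  have hq0 : 0 < q := by linarith
  have ha : 0 < (q - 1) / 2 := by linarith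
  refine ⟨ENNReal.ofReal ((4:ℝ) ^ (q - 1)) * ENNReal.ofReal (1 / ((q - 1) / 2)),
    ENNReal.mul_ne_top ENNReal.ofReal_ne_top ENNReal.ofReal_ne_top, fun f hf => ?_⟩
  calc _ ≤ ∫⁻ r in Ioi (1:ℝ), ENNReal.ofReal ((4:ℝ) ^ (q - 1)) *
        (ENNReal.ofReal (Real.exp (-((q - 1) / 2) * r)) * ∫⁻ s in Iic r,
          f s ^ q * ENNReal.ofReal (Real.exp ((q - 1) / 2 * s)) ∂sinhMeasure) := by
        refine setLIntegral_mono' measurableSet_Ioi fun r hr => ?_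
        have hr1 : (1:ℝ) < r := hr
        have hs : 0 < Real.sinh r := Real.sinh_pos_iff.2 (by linarith)
        have hreal : Real.exp ((q - 1) / 2 * r) * (Real.sinh r ^ q)⁻¹ * Real.sinh r
            ≤ 4 ^ (q - 1) * Real.exp (-((q - 1) / 2) * r) := by
          have e : (Real.sinh r ^ q)⁻¹ * Real.sinh r = (Real.sinh r ^ (q - 1))⁻¹ := by
            rw [Real.rpow_sub_one hs.ne']
            field_simp
          have l : (Real.exp r / 4) ^ (q - 1) ≤ Real.sinh r ^ (q - 1) :=
            Real.rpow_le_rpow (by positivity) (exp_div_four_le_sinh hr1.le) (by linarith)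
          rw [Real.div_rpow (Real.exp_pos _).le (by norm_num), ← Real.exp_mul] at l
          rw [mul_assoc, e, ← div_eq_mul_inv, div_le_iff₀ (by positivity)]
          have h4 : (0:ℝ) < 4 ^ (q - 1) := by positivity
          calc Real.exp ((q - 1) / 2 * r)
              = 4 ^ (q - 1) * Real.exp (-((q - 1) / 2) * r) *
                (Real.exp (r * (q - 1)) / 4 ^ (q - 1)) := by
                have : Real.exp ((q - 1) / 2 * r)
                    = Real.exp (-((q - 1) / 2) * r) * Real.exp (r * (q - 1)) := by
                  rw [← Real.exp_add]; congr 1; ring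
                rw [this]
                field_simp
            _ ≤ _ := by gcongr
        rw [ENNReal.div_rpow_of_nonneg _ _ hq0.le, ENNReal.ofReal_rpow_of_pos hs, div_eq_mul_inv,
          ← ENNReal.ofReal_inv_of_pos (by positivity)]
        calc _ ≤ (∫⁻ s in Iic r, f s ^ q *
              ENNReal.ofReal (Real.exp ((q - 1) / 2 * s)) ∂sinhMeasure) *
              ENNReal.ofReal (Real.exp ((q - 1) / 2 * r)) * ENNReal.ofReal (Real.sinh r ^ q)⁻¹ *
              ENNReal.ofReal (Real.sinh r) := by
              gcongr
              exact rpow_setLIntegral_Iic_sinhMeasure_le hq hf r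
          _ = (∫⁻ s in Iic r, f s ^ q *
              ENNReal.ofReal (Real.exp ((q - 1) / 2 * s)) ∂sinhMeasure) *
              ENNReal.ofReal (Real.exp ((q - 1) / 2 * r) * (Real.sinh r ^ q)⁻¹ * Real.sinh r) := by
              rw [ENNReal.ofReal_mul (by positivity), ENNReal.ofReal_mul (by positivity)]
              ring
          _ ≤ (∫⁻ s in Iic r, f s ^ q *
              ENNReal.ofReal (Real.exp ((q - 1) / 2 * s)) ∂sinhMeasure) *
              ENNReal.ofReal (4 ^ (q - 1) * Real.exp (-((q - 1) / 2) * r)) := by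
              gcongr
          _ = _ := by
              rw [ENNReal.ofReal_mul (by positivity)]
              ring
    _ ≤ ∫⁻ r, ENNReal.ofReal ((4:ℝ) ^ (q - 1)) *
        (ENNReal.ofReal (Real.exp (-((q - 1) / 2) * r)) * ∫⁻ s in Iic r,
          f s ^ q * ENNReal.ofReal (Real.exp ((q - 1) / 2 * s)) ∂sinhMeasure) :=
        setLIntegral_le_lintegral _ _
    _ = _ := by
        rw [lintegral_const_mul' _ _ ENNReal.ofReal_ne_top,
          lintegral_exp_mul_setLIntegral_Iic_sinhMeasure ha (hf.pow_const q), mul_assoc]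

lemma ae_nnnorm_le_wLinf (ε : ℝ → ℂ) :
    ∀ᵐ s ∂(volume.restrict (Ioi (0:ℝ))), (‖ε s‖₊ : ℝ≥0∞) ≤ wLinf ε :=
  ENNReal.ae_le_essSup _

lemma enorm_atheta_le {Q : ℝ → ℝ} {ε : ℝ → ℂ} (hQ : ∀ r ∈ Ioi (0:ℝ), 0 ≤ Q r ∧ Q r ≤ 1)
    (hε : Measurable ε) (r : ℝ) :
    ‖atheta Q ε r‖ₑ ≤ (1 + wLinf ε) * ∫⁻ s in Iic r, (‖ε s‖₊ : ℝ≥0∞) ∂sinhMeasure := by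
  rw [setLIntegral_Iic_sinhMeasure]
  have hsinh : ∀ s ∈ Ioc (0:ℝ) r, ‖Real.sinh s‖ₑ = ENNReal.ofReal (Real.sinh s) := fun s hs =>
    Real.enorm_of_nonneg (Real.sinh_nonneg_iff.2 hs.1.le)
  have h1 : ‖∫ s in Ioc (0:ℝ) r, Q s * (ε s).re * Real.sinh s‖ₑ
      ≤ ∫⁻ s in Ioc 0 r, (‖ε s‖₊ : ℝ≥0∞) * ENNReal.ofReal (Real.sinh s) := by
    refine (enorm_integral_le_lintegral_enorm _).trans
      (setLIntegral_mono' measurableSet_Ioc fun s hs => ?_)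
    rw [enorm_mul, enorm_mul, hsinh s hs]
    gcongr
    calc ‖Q s‖ₑ * ‖(ε s).re‖ₑ ≤ 1 * ‖ε s‖ₑ := by
          gcongr
          · rw [Real.enorm_of_nonneg (hQ s hs.1).1]
            exact ENNReal.ofReal_le_one.2 (hQ s hs.1).2
          · exact enorm_le_iff_norm_le.2 (Complex.abs_re_le_norm _)
      _ = _ := one_mul _
  have h2 : ‖∫ s in Ioc (0:ℝ) r, ‖ε s‖ ^ 2 * Real.sinh s‖ₑ
      ≤ wLinf ε * ∫⁻ s in Ioc 0 r, (‖ε s‖₊ : ℝ≥0∞) * ENNReal.ofReal (Real.sinh s) := by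
    refine (enorm_integral_le_lintegral_enorm _).trans ?_
    rw [← lintegral_const_mul _ (by fun_prop)]
    refine lintegral_mono_ae ?_
    filter_upwards [ae_restrict_mem measurableSet_Ioc,
      ae_restrict_of_ae_restrict_of_subset Ioc_subset_Ioi_self (ae_nnnorm_le_wLinf ε)] with s hs hA
    rw [enorm_mul, hsinh s hs, enorm_pow, enorm_norm, pow_two, ← mul_assoc]
    gcongr
    · exact hA
    · exact le_rfl
  have h3 : ‖(1 / 2 : ℝ)‖ₑ ≤ 1 := by
    rw [Real.enorm_of_nonneg (by norm_num)]
    exact ENNReal.ofReal_le_one.2 (by norm_num)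
  rw [atheta, add_mul, one_mul]
  refine enorm_sub_le.trans (add_le_add ?_ ?_)
  · rwa [enorm_neg]
  · rw [enorm_mul]
    calc _ ≤ 1 * _ := mul_le_mul' h3 h2
      _ = _ := one_mul _

lemma setLIntegral_Iic_nnnorm_le_wLinf_mul (ε : ℝ → ℂ) {r : ℝ} (hr : 0 < r) :
    ∫⁻ s in Iic r, (‖ε s‖₊ : ℝ≥0∞) ∂sinhMeasure
      ≤ wLinf ε * ENNReal.ofReal (r * Real.sinh r) := by
  rw [setLIntegral_Iic_sinhMeasure]
  calc _ ≤ ∫⁻ s in Ioc 0 r, wLinf ε * ENNReal.ofReal (Real.sinh r) := by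
        refine lintegral_mono_ae ?_
        filter_upwards [ae_restrict_mem measurableSet_Ioc,
          ae_restrict_of_ae_restrict_of_subset Ioc_subset_Ioi_self (ae_nnnorm_le_wLinf ε)]
          with s hs hA
        gcongr
        exact Real.sinh_le_sinh.2 hs.2
    _ = _ := by
        rw [setLIntegral_const, Real.volume_Ioc, sub_zero, ENNReal.ofReal_mul hr.le]
        ring

/-- Pointwise majorant of `coth r · (sinh r)⁻¹ · ∫₀^r |ε| sinh`. -/
def cothAverageMajorant (ε : ℝ → ℂ) : ℝ → ℝ≥0∞ :=
  (Iic (1:ℝ)).indicator (fun _ => wLinf ε) + (Ioi (1:ℝ)).indicator fun r =>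
    (∫⁻ s in Iic r, (‖ε s‖₊ : ℝ≥0∞) ∂sinhMeasure) / ENNReal.ofReal (Real.sinh r)

lemma measurable_setLIntegral_Iic_div_sinh (ε : ℝ → ℂ) : Measurable fun r : ℝ =>
    (∫⁻ s in Iic r, (‖ε s‖₊ : ℝ≥0∞) ∂sinhMeasure) / ENNReal.ofReal (Real.sinh r) := by
  have hmono : Monotone fun r : ℝ => ∫⁻ s in Iic r, (‖ε s‖₊ : ℝ≥0∞) ∂sinhMeasure :=
    fun r r' hrr => lintegral_mono_set (Iic_subset_Iic.2 hrr)
  exact hmono.measurable.div (by fun_prop)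

lemma measurable_cothAverageMajorant (ε : ℝ → ℂ) : Measurable (cothAverageMajorant ε) :=
  (measurable_const.indicator measurableSet_Iic).add
    ((measurable_setLIntegral_Iic_div_sinh ε).indicator measurableSet_Ioi)

lemma hcoth_nonneg {r : ℝ} (hr : 0 ≤ r) : 0 ≤ hcoth r :=
  div_nonneg (Real.cosh_pos r).le (Real.sinh_nonneg_iff.2 hr)

lemma coth_mul_average_le (ε : ℝ → ℂ) {r : ℝ} (hr : 0 < r) :
    ENNReal.ofReal (hcoth r) * ((∫⁻ s in Iic r, (‖ε s‖₊ : ℝ≥0∞) ∂sinhMeasure) /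
      ENNReal.ofReal (Real.sinh r)) ≤ 4 * cothAverageMajorant ε r := by
  have hs : 0 < Real.sinh r := Real.sinh_pos_iff.2 hr
  have h4 : (4 : ℝ≥0∞) = ENNReal.ofReal 4 := by simp
  rcases le_or_gt r 1 with h | h
  · have hm : cothAverageMajorant ε r = wLinf ε := by
      simp [cothAverageMajorant, h]
    rw [hm]
    calc _ ≤ ENNReal.ofReal (hcoth r) * (wLinf ε * ENNReal.ofReal (r * Real.sinh r) /
          ENNReal.ofReal (Real.sinh r)) := by
          gcongr
          exact setLIntegral_Iic_nnnorm_le_wLinf_mul ε hr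
      _ = ENNReal.ofReal (hcoth r * r) * wLinf ε := by
          rw [mul_div_assoc, ← ENNReal.ofReal_div_of_pos hs, mul_div_cancel_right₀ _ hs.ne',
            ENNReal.ofReal_mul (hcoth_nonneg hr.le)]
          ring
      _ ≤ _ := by
          rw [h4]
          gcongr
          rw [hcoth, div_mul_eq_mul_div, div_le_iff₀ hs]
          have h1 : r ≤ Real.sinh r := Real.self_le_sinh_iff.2 hr.le
          have h2 : Real.cosh r ≤ 4 := by
            have := Real.exp_one_lt_d9
            have a1 : Real.exp r ≤ Real.exp 1 := Real.exp_le_exp.2 h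
            have a2 : Real.exp (-r) ≤ 1 := Real.exp_le_one_iff.2 (by linarith)
            rw [Real.cosh_eq]
            linarith
          exact mul_le_mul h2 h1 hr.le (by norm_num)
  · have hm : cothAverageMajorant ε r = (∫⁻ s in Iic r, (‖ε s‖₊ : ℝ≥0∞) ∂sinhMeasure) /
        ENNReal.ofReal (Real.sinh r) := by
      simp [cothAverageMajorant, h]
    rw [hm, h4]
    gcongr
    rw [hcoth, div_le_iff₀ hs]
    have a1 := exp_div_four_le_sinh h.le
    have a2 : Real.exp (-r) ≤ Real.exp r := Real.exp_le_exp.2 (by linarith)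
    rw [Real.cosh_eq]
    linarith

lemma sinhMeasure_Iic_ne_top (r : ℝ) : sinhMeasure (Iic r) ≠ ⊤ := by
  rw [← setLIntegral_one, setLIntegral_Iic_sinhMeasure]
  refine ne_top_of_le_ne_top (b := ∫⁻ s in Ioc 0 r, ENNReal.ofReal (Real.sinh r)) ?_ ?_
  · rw [setLIntegral_const, Real.volume_Ioc]
    exact ENNReal.mul_ne_top ENNReal.ofReal_ne_top ENNReal.ofReal_ne_top
  · refine setLIntegral_mono' measurableSet_Ioc fun s hs => ?_
    rw [one_mul]
    exact ENNReal.ofReal_le_ofReal (Real.sinh_le_sinh.2 hs.2)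

lemma exists_cothAverageMajorant_Lp_le {q : ℝ} (hq : 1 < q) :
    ∃ C : ℝ≥0∞, C ≠ ⊤ ∧ ∀ ε : ℝ → ℂ, Measurable ε →
      (∫⁻ r, cothAverageMajorant ε r ^ q ∂sinhMeasure) ^ (1 / q)
        ≤ C * (wLinf ε + wLp q ε) := by
  have hq0 : 0 < q := by linarith
  have hqi : 0 ≤ 1 / q := by positivity
  obtain ⟨H, hH, hardy⟩ := exists_hardy_sinhMeasure hq
  refine ⟨sinhMeasure (Iic 1) ^ (1 / q) + H ^ (1 / q),
    ENNReal.add_ne_top.2 ⟨ENNReal.rpow_ne_top_of_nonneg hqi (sinhMeasure_Iic_ne_top 1),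
      ENNReal.rpow_ne_top_of_nonneg hqi hH⟩, fun ε hε => ?_⟩
  refine (ENNReal.lintegral_Lp_add_le
    (measurable_const.indicator measurableSet_Iic).aemeasurable
    ((measurable_setLIntegral_Iic_div_sinh ε).indicator measurableSet_Ioi).aemeasurable
    hq.le).trans ?_
  have hind : ∀ (s : Set ℝ) (g : ℝ → ℝ≥0∞) (r : ℝ),
      s.indicator g r ^ q = s.indicator (fun r => g r ^ q) r := fun s g r => by
    by_cases h : r ∈ s <;> simp [h, hq0]
  simp only [hind]
  have b1 : (∫⁻ r, (Iic (1:ℝ)).indicator (fun _ => wLinf ε ^ q) r ∂sinhMeasure) ^ (1 / q)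
      = sinhMeasure (Iic 1) ^ (1 / q) * wLinf ε := by
    rw [lintegral_indicator measurableSet_Iic, setLIntegral_const,
      ENNReal.mul_rpow_of_nonneg _ _ hqi, ← ENNReal.rpow_mul, mul_one_div_cancel hq0.ne',
      ENNReal.rpow_one, mul_comm]
  have b2 : (∫⁻ r, (Ioi (1:ℝ)).indicator (fun r =>
      ((∫⁻ s in Iic r, (‖ε s‖₊ : ℝ≥0∞) ∂sinhMeasure) / ENNReal.ofReal (Real.sinh r)) ^ q) r
        ∂sinhMeasure) ^ (1 / q) ≤ H ^ (1 / q) * wLp q ε := by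
    rw [wLp_eq_lintegral_sinhMeasure, ← ENNReal.mul_rpow_of_nonneg _ _ hqi]
    refine ENNReal.rpow_le_rpow (le_trans (le_of_eq ?_) (hardy _ (by fun_prop))) hqi
    rw [lintegral_sinhMeasure]
    have hmul : ∀ (g : ℝ → ℝ≥0∞) (r : ℝ),
        (Ioi (1:ℝ)).indicator g r * ENNReal.ofReal (Real.sinh r)
          = (Ioi (1:ℝ)).indicator (fun r => g r * ENNReal.ofReal (Real.sinh r)) r :=
      fun g r => by by_cases h : r ∈ Ioi (1:ℝ) <;> simp [h]
    simp only [hmul]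
    rw [lintegral_indicator measurableSet_Ioi, Measure.restrict_restrict measurableSet_Ioi,
      Ioi_inter_Ioi]
    simp
  rw [b1]
  calc _ ≤ sinhMeasure (Iic 1) ^ (1 / q) * wLinf ε + H ^ (1 / q) * wLp q ε := by gcongr
    _ ≤ (sinhMeasure (Iic 1) ^ (1 / q) + H ^ (1 / q)) * wLinf ε +
        (sinhMeasure (Iic 1) ^ (1 / q) + H ^ (1 / q)) * wLp q ε := by
      gcongr
      · exact le_self_add
      · exact le_add_self
    _ = _ := (mul_add _ _ _).symm

/-- **Weighted bilinear bound:** for `1 < p, p₁, p₂ < ∞` with `1/p₁ + 1/p₂ = 1/p`,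
`‖coth(r)·(a_θ/sinh r)·ε₁‖_{L^p} ≤ C(1+‖ε‖_∞)(‖ε‖_∞ + ‖ε‖_{L^{p₁}})‖ε₁‖_{L^{p₂}}`. -/
theorem coth_atheta_eps1_bilinear_bound
    (m : ℕ) (hm : 1 ≤ m) (C_Q : ℝ)
    (p p₁ p₂ : ℝ) (hp : 1 < p) (hp₁ : 1 < p₁) (hp₂ : 1 < p₂)
    (hHolder : 1/p₁ + 1/p₂ = 1/p) :
    ∃ C > (0:ℝ), ∀ (Q : ℝ → ℝ) (ε ε₁ : ℝ → ℂ),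
      Measurable Q →
      (∀ r ∈ Set.Ioi (0:ℝ), 0 ≤ Q r ∧ Q r ≤ min (C_Q * r ^ m) 1) →
      Measurable ε → Measurable ε₁ →
      wLinf ε < ⊤ → wLp p₁ ε < ⊤ → wLp p₂ ε₁ < ⊤ →
      wLp p (fun r => ((hcoth r * (atheta Q ε r / Real.sinh r) : ℝ) : ℂ) * ε₁ r)
        ≤ ENNReal.ofReal C *
          ((1 + wLinf ε) * (wLinf ε + wLp p₁ ε) * wLp p₂ ε₁) := by
  have hp0 : 0 < p := by linarith
  have hp₁0 : 0 < p₁ := by linarith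
  have hp₂0 : 0 < p₂ := by linarith
  have hpp : p < p₁ := by
    have : 1 / p₁ < 1 / p := by rw [← hHolder]; linarith [one_div_pos.2 hp₂0]
    exact (one_div_lt_one_div hp₁0 hp0).1 this
  obtain ⟨K, hK, hmaj⟩ := exists_cothAverageMajorant_Lp_le hp₁
  refine ⟨4 * K.toReal + 1, by positivity, fun Q ε ε₁ _ hQ hε hε₁ _ _ _ => ?_⟩
  have hQ' : ∀ r ∈ Ioi (0:ℝ), 0 ≤ Q r ∧ Q r ≤ 1 := fun r hr =>
    ⟨(hQ r hr).1, (hQ r hr).2.trans (min_le_right _ _)⟩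
  set M := cothAverageMajorant ε
  have hMm : Measurable M := measurable_cothAverageMajorant ε
  have hpt : ∀ r ∈ Ioi (0:ℝ), (‖((hcoth r * (atheta Q ε r / Real.sinh r) : ℝ) : ℂ) * ε₁ r‖₊ : ℝ≥0∞)
      ≤ 4 * (1 + wLinf ε) * M r * ‖ε₁ r‖₊ := fun r hr => by
    have hs : 0 < Real.sinh r := Real.sinh_pos_iff.2 hr
    rw [nnnorm_mul, ENNReal.coe_mul, Complex.nnnorm_real]
    gcongr
    change ‖hcoth r * (atheta Q ε r / Real.sinh r)‖ₑ ≤ _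
    rw [div_eq_mul_inv, enorm_mul, enorm_mul, Real.enorm_of_nonneg (inv_pos.2 hs).le,
      Real.enorm_of_nonneg (hcoth_nonneg (le_of_lt hr)),
      ENNReal.ofReal_inv_of_pos hs]
    calc _ ≤ ENNReal.ofReal (hcoth r) * ((1 + wLinf ε) *
          (∫⁻ s in Iic r, (‖ε s‖₊ : ℝ≥0∞) ∂sinhMeasure) * (ENNReal.ofReal (Real.sinh r))⁻¹) := by
          gcongr
          exact enorm_atheta_le hQ' hε r
      _ = (1 + wLinf ε) * (ENNReal.ofReal (hcoth r) *
          ((∫⁻ s in Iic r, (‖ε s‖₊ : ℝ≥0∞) ∂sinhMeasure) / ENNReal.ofReal (Real.sinh r))) := by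
          rw [div_eq_mul_inv]; ring
      _ ≤ (1 + wLinf ε) * (4 * M r) := by
          exact mul_le_mul' le_rfl (coth_mul_average_le ε hr)
      _ = _ := by ring
  calc _ ≤ (∫⁻ r, ((fun r => 4 * (1 + wLinf ε) * M r) * fun r => (‖ε₁ r‖₊ : ℝ≥0∞)) r ^ p
        ∂sinhMeasure) ^ (1 / p) := by
        rw [wLp, lintegral_sinhMeasure]
        refine ENNReal.rpow_le_rpow (setLIntegral_mono' measurableSet_Ioi fun r hr => ?_)
          (by positivity)
        gcongr
        exact hpt r hr
    _ ≤ (∫⁻ r, (4 * (1 + wLinf ε) * M r) ^ p₁ ∂sinhMeasure) ^ (1 / p₁) * wLp p₂ ε₁ := by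
        rw [wLp_eq_lintegral_sinhMeasure p₂]
        exact ENNReal.lintegral_Lp_mul_le_Lq_mul_Lr hp0 hpp hHolder.symm sinhMeasure
          (by fun_prop) (by fun_prop)
    _ = 4 * (1 + wLinf ε) * (∫⁻ r, M r ^ p₁ ∂sinhMeasure) ^ (1 / p₁) * wLp p₂ ε₁ := by
        congr 1
        simp only [ENNReal.mul_rpow_of_nonneg _ (M _) hp₁0.le]
        rw [lintegral_const_mul _ (hMm.pow_const _),
          ENNReal.mul_rpow_of_nonneg _ _ (by positivity), ← ENNReal.rpow_mul,
          mul_one_div_cancel hp₁0.ne', ENNReal.rpow_one]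
    _ ≤ 4 * (1 + wLinf ε) * (K * (wLinf ε + wLp p₁ ε)) * wLp p₂ ε₁ := by
        gcongr
        exact hmaj ε hε
    _ = 4 * K * ((1 + wLinf ε) * (wLinf ε + wLp p₁ ε) * wLp p₂ ε₁) := by ring
    _ ≤ _ := by
        gcongr
        rw [ENNReal.ofReal_add (by positivity) zero_le_one, ENNReal.ofReal_mul (by norm_num),
          ENNReal.ofReal_toReal hK]
        simp

end
end

section
/- Control of ‖ε/sinh(r)‖ and ‖∂_r ε‖ by ε₁: under the stated hypotheses, for every 2 ≤ p < ∞ there is C > 0 such that ‖ε/sinh(r)‖_{L^p} ≤ C(‖ε₁‖_{L^p} + (1 + ‖ε‖_{L^∞})‖g‖_{L^p}) and ‖∂_r ε‖_{L^p} ≤ C(‖ε₁‖_{L^p} + (1 + ‖ε‖_{L^∞})‖g‖_{L^p}). -/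
/- Control of ‖ε/sinh r‖_{L^p} and ‖∂_r ε‖_{L^p} by ε₁. -/

open MeasureTheory Set Filter
open scoped ENNReal NNReal Topology

noncomputable section

/-- Comparison of `sinh` with the linear function for small arguments. -/
lemma sinh_le_mul_cosh {s : ℝ} (hs : 0 ≤ s) : Real.sinh s ≤ s * Real.cosh s := by
  have hd : ∀ x : ℝ, HasDerivAt (fun x => x * Real.cosh x - Real.sinh x) (x * Real.sinh x) x := by
    intro x
    have h := ((hasDerivAt_id x).mul (Real.hasDerivAt_cosh x)).sub (Real.hasDerivAt_sinh x)
    refine h.congr_deriv ?_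
    simp
  have hmono : MonotoneOn (fun x => x * Real.cosh x - Real.sinh x) (Ici 0) := by
    refine monotoneOn_of_deriv_nonneg (convex_Ici 0)
      (fun x _ => (hd x).continuousAt.continuousWithinAt)
      (fun x _ => (hd x).differentiableAt.differentiableWithinAt) ?_
    intro x hx
    rw [interior_Ici] at hx
    rw [(hd x).deriv]
    exact mul_nonneg (le_of_lt hx) (Real.sinh_nonneg_iff.2 (le_of_lt hx))
  have h := hmono (mem_Ici.2 le_rfl) (mem_Ici.2 hs) hs
  simp at h
  linarith

lemma sinh_le_min_mul_cosh {s : ℝ} (hs : 0 ≤ s) : Real.sinh s ≤ min s 1 * Real.cosh s := by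
  rcases min_choice s 1 with h | h <;> rw [h]
  · exact sinh_le_mul_cosh hs
  · rw [one_mul]; exact (Real.sinh_lt_cosh s).le

lemma min_mul_cosh_le {r : ℝ} (hr : 0 ≤ r) : min r 1 * Real.cosh r ≤ 2 * Real.sinh r := by
  have h1 : Real.cosh r = Real.sinh r + Real.exp (-r) := by
    rw [← Real.cosh_sub_sinh]; ring
  have h2 : Real.exp (-r) ≤ 1 := Real.exp_le_one_iff.2 (by linarith)
  have h3 : r ≤ Real.sinh r := Real.self_le_sinh_iff.2 hr
  have h4 : 0 ≤ Real.exp (-r) := (Real.exp_pos _).le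
  have h5 : 0 ≤ min r 1 := le_min hr zero_le_one
  rw [h1]
  nlinarith [min_le_left r 1, min_le_right r 1]

lemma tendsto_sinh_atTop : Tendsto Real.sinh atTop atTop :=
  tendsto_atTop_mono' _ ((eventually_ge_atTop 0).mono fun _ hx => Real.self_le_sinh_iff.2 hx)
    tendsto_id

/-- The primitive of `cosh * sinh ^ (-q)` on a half-line, for `q > 1`. -/
lemma lintegral_cosh_mul_sinh_rpow {q r : ℝ} (hq : 1 < q) (hr : 0 < r) :
    ∫⁻ s in Ioi r, ENNReal.ofReal (Real.cosh s * Real.sinh s ^ (-q))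
      = ENNReal.ofReal (Real.sinh r ^ (1 - q) / (q - 1)) := by
  have hq' : q - 1 ≠ 0 := by linarith
  have hd : ∀ x ∈ Ici r, HasDerivAt (fun x => -(Real.sinh x ^ (1 - q) / (q - 1)))
      (Real.cosh x * Real.sinh x ^ (-q)) x := by
    intro x hx
    have hx0 : 0 < Real.sinh x := Real.sinh_pos_iff.2 (hr.trans_le hx)
    have h := (((Real.hasDerivAt_sinh x).rpow_const (p := 1 - q) (Or.inl hx0.ne')).div_const
      (q - 1)).neg
    refine h.congr_deriv ?_
    rw [show 1 - q - 1 = -q by ring]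
    field_simp
    ring
  have hpos : ∀ x ∈ Ioi r, 0 ≤ Real.cosh x * Real.sinh x ^ (-q) := fun x hx =>
    mul_nonneg (Real.cosh_pos x).le
      (Real.rpow_nonneg (Real.sinh_nonneg_iff.2 (hr.trans hx).le) _)
  have hlim : Tendsto (fun x => -(Real.sinh x ^ (1 - q) / (q - 1))) atTop (𝓝 0) := by
    have h := (tendsto_rpow_neg_atTop (y := q - 1) (by linarith)).comp tendsto_sinh_atTop
    have h2 := (h.div_const (q - 1)).neg
    simpa using h2
  rw [← ofReal_integral_eq_lintegral_ofReal (integrableOn_Ioi_deriv_of_nonneg' hd hpos hlim)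
    (ae_restrict_of_forall_mem measurableSet_Ioi hpos),
    integral_Ioi_of_hasDerivAt_of_nonneg' hd hpos hlim]
  simp

lemma lintegral_inv_cosh_sq {s : ℝ} (hs : 0 < s) :
    ∫⁻ r in Ioc 0 s, ENNReal.ofReal (1 / Real.cosh r) ^ (2 : ℝ)
      = ENNReal.ofReal (Real.sinh s / Real.cosh s) := by
  have hc : Continuous fun r : ℝ => (1 / Real.cosh r) ^ 2 :=
    (continuous_const.div Real.continuous_cosh fun x => (Real.cosh_pos x).ne').pow 2
  have hd : ∀ x ∈ uIcc 0 s, HasDerivAt (fun x => Real.sinh x / Real.cosh x)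
      ((1 / Real.cosh x) ^ 2) x := by
    intro x _
    refine ((Real.hasDerivAt_sinh x).div (Real.hasDerivAt_cosh x)
      (Real.cosh_pos x).ne').congr_deriv ?_
    rw [div_pow, one_pow, ← Real.cosh_sq_sub_sinh_sq x]
    ring
  have h := intervalIntegral.integral_eq_sub_of_hasDerivAt hd (hc.intervalIntegrable 0 s)
  rw [intervalIntegral.integral_of_le hs.le] at h
  have h2 : Real.sinh s / Real.cosh s = ∫ x in Ioc 0 s, (1 / Real.cosh x) ^ 2 := by
    rw [h]; simp
  rw [h2, ofReal_integral_eq_lintegral_ofReal]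
  · refine lintegral_congr fun r => ?_
    rw [ENNReal.ofReal_rpow_of_pos (one_div_pos.2 (Real.cosh_pos r))]
    norm_num
  · exact (hc.intervalIntegrable 0 s).1
  · exact Eventually.of_forall fun x => sq_nonneg _

/-- Pointwise Hölder estimate for the tail integral `∫_r^∞ f coth`. -/
lemma tail_rpow_mul_sinh_le {p r : ℝ} (hp : 1 < p) (hr : 0 < r) {f : ℝ → ℝ≥0∞}
    (hf : AEMeasurable f (volume.restrict (Ioi 0))) :
    (∫⁻ s in Ioi r, f s * ENNReal.ofReal (Real.cosh s / Real.sinh s)) ^ p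
        * ENNReal.ofReal (Real.sinh r)
      ≤ ENNReal.ofReal ((p - 1) ^ (p - 1))
        * ∫⁻ s in Ioi r, f s ^ p * ENNReal.ofReal (Real.cosh s) := by
  set q := p.conjExponent with hqdef
  have hpq : p.HolderConjugate q := Real.HolderConjugate.conjExponent hp
  have hp0 : 0 < p := by linarith
  have hq1 : 1 < q := hpq.symm.lt
  have hq0 : 0 < q := by linarith
  have hqp : q - 1 = 1 / (p - 1) := by
    rw [hqdef, Real.conjExponent]; field_simp [show p - 1 ≠ 0 by linarith]; ring
  have hfr : AEMeasurable f (volume.restrict (Ioi r)) :=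
    hf.mono_measure (Measure.restrict_mono (Ioi_subset_Ioi hr.le) le_rfl)
  have hmc : Measurable fun s => ENNReal.ofReal (Real.cosh s) :=
    Real.measurable_cosh.ennreal_ofReal
  have hH := ENNReal.lintegral_mul_le_Lp_mul_Lq (volume.restrict (Ioi r)) hpq
    (f := fun s => f s * ENNReal.ofReal (Real.cosh s) ^ (1 / p))
    (g := fun s => ENNReal.ofReal (Real.cosh s) ^ (1 / q) * ENNReal.ofReal (Real.sinh s)⁻¹)
    (hfr.mul (hmc.pow_const _).aemeasurable)
    ((hmc.pow_const _).mul Real.measurable_sinh.inv.ennreal_ofReal).aemeasurable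
  have e1 : ∫⁻ s in Ioi r, ((fun s => f s * ENNReal.ofReal (Real.cosh s) ^ (1 / p)) *
      (fun s => ENNReal.ofReal (Real.cosh s) ^ (1 / q) * ENNReal.ofReal (Real.sinh s)⁻¹)) s
      = ∫⁻ s in Ioi r, f s * ENNReal.ofReal (Real.cosh s / Real.sinh s) := by
    refine lintegral_congr fun s => ?_
    have hc := ENNReal.ofReal_pos.2 (Real.cosh_pos s)
    have h1 : ENNReal.ofReal (Real.cosh s) ^ (1 / p) * ENNReal.ofReal (Real.cosh s) ^ (1 / q)
        = ENNReal.ofReal (Real.cosh s) := by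
      rw [← ENNReal.rpow_add _ _ hc.ne' ENNReal.ofReal_ne_top,
        one_div, one_div, hpq.inv_add_inv_eq_one, ENNReal.rpow_one]
    simp only [Pi.mul_apply]
    calc _ = f s * ((ENNReal.ofReal (Real.cosh s) ^ (1 / p)
          * ENNReal.ofReal (Real.cosh s) ^ (1 / q)) * ENNReal.ofReal (Real.sinh s)⁻¹) := by ring
      _ = _ := by rw [h1, ← ENNReal.ofReal_mul (Real.cosh_pos s).le, ← div_eq_mul_inv]
  have e2 : ∫⁻ s in Ioi r, (f s * ENNReal.ofReal (Real.cosh s) ^ (1 / p)) ^ p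
      = ∫⁻ s in Ioi r, f s ^ p * ENNReal.ofReal (Real.cosh s) := by
    refine lintegral_congr fun s => ?_
    rw [ENNReal.mul_rpow_of_nonneg _ _ hp0.le, ← ENNReal.rpow_mul,
      one_div_mul_cancel hp0.ne', ENNReal.rpow_one]
  have e3 : ∫⁻ s in Ioi r,
      (ENNReal.ofReal (Real.cosh s) ^ (1 / q) * ENNReal.ofReal (Real.sinh s)⁻¹) ^ q
      = ENNReal.ofReal (Real.sinh r ^ (1 - q) / (q - 1)) := by
    rw [← lintegral_cosh_mul_sinh_rpow hq1 hr]
    refine setLIntegral_congr_fun measurableSet_Ioi fun s hs => ?_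
    have hs0 : 0 < Real.sinh s := Real.sinh_pos_iff.2 (hr.trans hs)
    rw [ENNReal.mul_rpow_of_nonneg _ _ hq0.le, ← ENNReal.rpow_mul,
      one_div_mul_cancel hq0.ne', ENNReal.rpow_one,
      ENNReal.ofReal_rpow_of_pos (inv_pos.2 hs0), Real.inv_rpow hs0.le, ← Real.rpow_neg hs0.le,
      ENNReal.ofReal_mul (Real.cosh_pos s).le]
  rw [e1, e2, e3] at hH
  have hs0 : 0 < Real.sinh r := Real.sinh_pos_iff.2 hr
  have hconst : ENNReal.ofReal (Real.sinh r ^ (1 - q) / (q - 1)) ^ (1 / q * p)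
      * ENNReal.ofReal (Real.sinh r) = ENNReal.ofReal ((p - 1) ^ (p - 1)) := by
    have hp1 : 0 < p - 1 := by linarith
    have hexp : 1 / q * p = p - 1 := by
      rw [hqdef, Real.conjExponent]; field_simp
    rw [hexp, show 1 - q = -(1 / (p - 1)) by linarith, hqp, div_div_eq_mul_div, div_one,
      ENNReal.ofReal_rpow_of_pos (mul_pos (Real.rpow_pos_of_pos hs0 _) hp1),
      ← ENNReal.ofReal_mul (by positivity), Real.mul_rpow (by positivity) hp1.le,
      ← Real.rpow_mul hs0.le, neg_mul, one_div_mul_cancel hp1.ne', Real.rpow_neg_one]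
    congr 1
    field_simp
  calc _ ≤ ((∫⁻ s in Ioi r, f s ^ p * ENNReal.ofReal (Real.cosh s)) ^ (1 / p) *
        ENNReal.ofReal (Real.sinh r ^ (1 - q) / (q - 1)) ^ (1 / q)) ^ p
        * ENNReal.ofReal (Real.sinh r) := by gcongr
    _ = _ := by
      rw [ENNReal.mul_rpow_of_nonneg _ _ hp0.le, ← ENNReal.rpow_mul, ← ENNReal.rpow_mul,
        one_div_mul_cancel hp0.ne', ENNReal.rpow_one, mul_assoc, hconst, mul_comm]

/-- Tonelli's theorem on the triangle `0 < r < s`. -/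
lemma lintegral_triangle_swap {F G : ℝ → ℝ≥0∞} (hF : AEMeasurable F (volume.restrict (Ioi 0)))
    (hG : Measurable G) :
    ∫⁻ r in Ioi 0, G r * ∫⁻ s in Ioi r, F s
      ≤ ∫⁻ s in Ioi 0, F s * ∫⁻ r in Ioc 0 s, G r := by
  have h1 : ∫⁻ r in Ioi (0:ℝ), G r * ∫⁻ s in Ioi r, F s
      = ∫⁻ r in Ioi (0:ℝ), ∫⁻ s in Ioi (0:ℝ),
        ({x : ℝ × ℝ | x.1 < x.2}.indicator 1 (r, s)) * (G r * F s) := by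
    refine setLIntegral_congr_fun measurableSet_Ioi fun r hr => ?_
    rw [← lintegral_const_mul'' _
      (hF.mono_measure (Measure.restrict_mono (Ioi_subset_Ioi (le_of_lt hr)) le_rfl)),
      ← lintegral_indicator measurableSet_Ioi, ← lintegral_indicator measurableSet_Ioi]
    refine lintegral_congr fun s => ?_
    by_cases hs : r < s
    · simp [indicator, hs, (show 0 < r from hr).trans hs]
    · simp [indicator, hs]
  rw [h1, lintegral_lintegral_swap]
  · refine setLIntegral_mono_ae' measurableSet_Ioi (Eventually.of_forall fun s hs => ?_)
    rw [← lintegral_const_mul _ hG, ← lintegral_indicator measurableSet_Ioi,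
      ← lintegral_indicator measurableSet_Ioc]
    refine lintegral_mono fun r => ?_
    by_cases hr : 0 < r
    · by_cases hrs : r < s
      · simp [indicator, hr, hrs, hrs.le, mul_comm]
      · simp [indicator, hrs]
    · simp [indicator, hr]
  · refine AEMeasurable.mul ?_ ((hG.comp measurable_fst).aemeasurable.mul
      hF.comp_snd)
    exact (measurable_one.indicator
      (measurableSet_lt measurable_fst measurable_snd)).aemeasurable

/-- A Hardy inequality for the weight `sinh` on the half-line. -/
lemma lintegral_hardy_sinh {p : ℝ} (hp : 2 ≤ p) {f : ℝ → ℝ≥0∞}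
    (hf : AEMeasurable f (volume.restrict (Ioi 0))) :
    ∫⁻ r in Ioi 0, (ENNReal.ofReal (1 / Real.cosh r) *
        ∫⁻ s in Ioi r, f s * ENNReal.ofReal (Real.cosh s / Real.sinh s)) ^ p
        * ENNReal.ofReal (Real.sinh r)
      ≤ ENNReal.ofReal ((p - 1) ^ (p - 1))
        * ∫⁻ s in Ioi 0, f s ^ p * ENNReal.ofReal (Real.sinh s) := by
  have hF : AEMeasurable (fun s => f s ^ p * ENNReal.ofReal (Real.cosh s))
      (volume.restrict (Ioi 0)) :=
    (hf.pow_const p).mul Real.measurable_cosh.ennreal_ofReal.aemeasurable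
  have hG : Measurable fun r => ENNReal.ofReal (1 / Real.cosh r) ^ (2 : ℝ) :=
    ((measurable_const.div Real.measurable_cosh).ennreal_ofReal).pow_const _
  calc _ ≤ ∫⁻ r in Ioi 0, ENNReal.ofReal ((p - 1) ^ (p - 1)) *
        (ENNReal.ofReal (1 / Real.cosh r) ^ (2 : ℝ) *
          ∫⁻ s in Ioi r, f s ^ p * ENNReal.ofReal (Real.cosh s)) := by
        refine setLIntegral_mono_ae' measurableSet_Ioi (Eventually.of_forall fun r hr => ?_)
        have h := tail_rpow_mul_sinh_le (by linarith : 1 < p) hr hf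
        have hc : ENNReal.ofReal (1 / Real.cosh r) ^ p
            ≤ ENNReal.ofReal (1 / Real.cosh r) ^ (2 : ℝ) := by
          refine ENNReal.rpow_le_rpow_of_exponent_ge ?_ hp
          rw [ENNReal.ofReal_le_one, div_le_one (Real.cosh_pos r)]
          exact Real.one_le_cosh r
        rw [ENNReal.mul_rpow_of_nonneg _ _ (by linarith), mul_assoc]
        rw [mul_left_comm (ENNReal.ofReal ((p - 1) ^ (p - 1)))]
        exact mul_le_mul' hc h
    _ = ENNReal.ofReal ((p - 1) ^ (p - 1)) * ∫⁻ r in Ioi 0,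
        ENNReal.ofReal (1 / Real.cosh r) ^ (2 : ℝ) *
          ∫⁻ s in Ioi r, f s ^ p * ENNReal.ofReal (Real.cosh s) :=
        lintegral_const_mul' _ _ ENNReal.ofReal_ne_top
    _ ≤ _ := by
        refine mul_le_mul' le_rfl ((lintegral_triangle_swap hF hG).trans_eq ?_)
        refine setLIntegral_congr_fun measurableSet_Ioi fun s hs => ?_
        rw [lintegral_inv_cosh_sq hs, mul_assoc, ← ENNReal.ofReal_mul (Real.cosh_pos s).le,
          mul_div_cancel₀ _ (Real.cosh_pos s).ne']

/-- The weighted `L^p` norm of an extended-nonnegative function. -/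
def wNorm (p : ℝ) (f : ℝ → ℝ≥0∞) : ℝ≥0∞ :=
  (∫⁻ r in Ioi (0:ℝ), f r ^ p * ENNReal.ofReal (Real.sinh r)) ^ (1/p)

lemma wLp_eq_wNorm {E : Type*} [SeminormedAddGroup E] (p : ℝ) (F : ℝ → E) :
    wLp p F = wNorm p (fun r => ‖F r‖ₑ) := rfl

lemma wNorm_mono_ae {p : ℝ} (hp : 0 < p) {f h : ℝ → ℝ≥0∞}
    (hfh : ∀ᵐ r ∂volume.restrict (Ioi 0), f r ≤ h r) : wNorm p f ≤ wNorm p h := by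
  refine ENNReal.rpow_le_rpow (lintegral_mono_ae (hfh.mono fun r hr => ?_)) (by positivity)
  gcongr

lemma wNorm_const_mul {p : ℝ} (hp : 0 < p) {k : ℝ≥0∞} (hk : k ≠ ⊤) (f : ℝ → ℝ≥0∞) :
    wNorm p (fun r => k * f r) = k * wNorm p f := by
  unfold wNorm
  simp_rw [ENNReal.mul_rpow_of_nonneg _ _ hp.le, mul_assoc]
  rw [lintegral_const_mul' _ _ (ENNReal.rpow_ne_top_of_nonneg hp.le hk),
    ENNReal.mul_rpow_of_nonneg _ _ (by positivity), ← ENNReal.rpow_mul,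
    mul_one_div_cancel hp.ne', ENNReal.rpow_one]

lemma wNorm_add_le {p : ℝ} (hp : 1 ≤ p) {f h : ℝ → ℝ≥0∞}
    (hf : AEMeasurable f (volume.restrict (Ioi 0)))
    (hh : AEMeasurable h (volume.restrict (Ioi 0))) :
    wNorm p (fun r => f r + h r) ≤ wNorm p f + wNorm p h := by
  have hp0 : 0 < p := by linarith
  have hw : Measurable fun r => ENNReal.ofReal (Real.sinh r) ^ (1 / p) :=
    Real.measurable_sinh.ennreal_ofReal.pow_const _
  have key : ∀ k : ℝ → ℝ≥0∞, wNorm p k = (∫⁻ r in Ioi (0:ℝ),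
      (k r * ENNReal.ofReal (Real.sinh r) ^ (1 / p)) ^ p) ^ (1 / p) := by
    intro k
    unfold wNorm
    simp_rw [ENNReal.mul_rpow_of_nonneg _ _ hp0.le, ← ENNReal.rpow_mul,
      one_div_mul_cancel hp0.ne', ENNReal.rpow_one]
  rw [key, key, key]
  have h := ENNReal.lintegral_Lp_add_le (hf.mul hw.aemeasurable) (hh.mul hw.aemeasurable) hp
  simpa only [Pi.add_apply, Pi.mul_apply, add_mul] using h

lemma wNorm_hardy {p : ℝ} (hp : 2 ≤ p) {f : ℝ → ℝ≥0∞}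
    (hf : AEMeasurable f (volume.restrict (Ioi 0))) :
    wNorm p (fun r => ENNReal.ofReal (1 / Real.cosh r) *
        ∫⁻ s in Ioi r, f s * ENNReal.ofReal (Real.cosh s / Real.sinh s))
      ≤ ENNReal.ofReal (((p - 1) ^ (p - 1)) ^ (1 / p)) * wNorm p f := by
  have hp0 : 0 < p := by linarith
  have hp1 : 0 < p - 1 := by linarith
  rw [← ENNReal.ofReal_rpow_of_pos (Real.rpow_pos_of_pos hp1 _)]
  unfold wNorm
  rw [← ENNReal.mul_rpow_of_nonneg _ _ (by positivity)]
  exact ENNReal.rpow_le_rpow (lintegral_hardy_sinh hp hf) (by positivity)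

/-- A function comparable to `min (r ^ m) 1` has ratios controlled by ratios of `tanh`. -/
lemma div_le_of_comparable_min_pow {m : ℕ} (hm : 1 ≤ m) {Q : ℝ → ℝ} {c C : ℝ} (hc : 0 < c)
    (hcC : c ≤ C) (hlb : ∀ r ∈ Ioi (0:ℝ), c * min (r ^ m) 1 ≤ Q r)
    (hub : ∀ r ∈ Ioi (0:ℝ), Q r ≤ C * min (r ^ m) 1) {r s : ℝ} (hr : 0 < r) (hrs : r ≤ s) :
    Q r / Q s ≤ 2 * C / c * (Real.sinh r / Real.cosh r * (Real.cosh s / Real.sinh s)) := by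
  have hs : 0 < s := hr.trans_le hrs
  have hpow : ∀ x : ℝ, 0 < x → min (x ^ m) 1 = min x 1 ^ m := by
    intro x hx
    rcases le_total x 1 with h | h
    · rw [min_eq_left h, min_eq_left (pow_le_one₀ hx.le h)]
    · rw [min_eq_right h, min_eq_right (one_le_pow₀ h), one_pow]
  have hC : 0 < C := hc.trans_le hcC
  have hr1 : 0 < min r 1 := lt_min hr one_pos
  have hs1 : 0 < min s 1 := lt_min hs one_pos
  have hsr : 0 < Real.sinh r := Real.sinh_pos_iff.2 hr
  have hss : 0 < Real.sinh s := Real.sinh_pos_iff.2 hs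
  have hcr := Real.cosh_pos r
  have hcs := Real.cosh_pos s
  have h1 : Q r / Q s ≤ C * min r 1 ^ m / (c * min s 1 ^ m) := by
    have ha := hub r hr
    have hb := hlb s hs
    rw [hpow _ hr] at ha
    rw [hpow _ hs] at hb
    exact div_le_div₀ (by positivity) ha (by positivity) hb
  have h2 : (min r 1 / min s 1) ^ m ≤ min r 1 / min s 1 :=
    pow_le_of_le_one (by positivity) ((div_le_one hs1).2 (min_le_min_right 1 hrs)) (by omega)
  have h3 : min r 1 ≤ 2 * (Real.sinh r / Real.cosh r) := by
    rw [← mul_div_assoc, le_div_iff₀ hcr]; exact min_mul_cosh_le hr.le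
  have h4 : (min s 1)⁻¹ ≤ Real.cosh s / Real.sinh s := by
    rw [inv_eq_one_div, div_le_div_iff₀ hs1 hss]
    linarith [sinh_le_min_mul_cosh hs.le]
  calc Q r / Q s ≤ C * min r 1 ^ m / (c * min s 1 ^ m) := h1
    _ = C / c * (min r 1 / min s 1) ^ m := by rw [div_pow]; field_simp
    _ ≤ C / c * (min r 1 * (min s 1)⁻¹) := by
        rw [← div_eq_mul_inv]; gcongr
    _ ≤ C / c * (2 * (Real.sinh r / Real.cosh r) * (Real.cosh s / Real.sinh s)) := by gcongr
    _ = _ := by ring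

/-- Pointwise control of `ε / sinh` obtained from the integral representation of `ε`. -/
lemma enorm_div_sinh_le {Q : ℝ → ℝ} {B C r : ℝ} {M : ℝ≥0∞} {g : ℝ → ℝ} {ε ε₁ : ℝ → ℂ}
    (hB : 0 ≤ B) (hr : 0 < r) (hQpos : ∀ s ∈ Ioi (0:ℝ), 0 < Q s)
    (hQC : ∀ s ∈ Ioi (0:ℝ), Q s ≤ C)
    (hQ : ∀ s ∈ Ioi r,
      Q r / Q s ≤ B * (Real.sinh r / Real.cosh r * (Real.cosh s / Real.sinh s)))
    (hM : ∀ᵐ s ∂volume.restrict (Ioi 0), ‖ε s‖ₑ ≤ M)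
    (hi₁ : IntegrableOn (fun s => ε₁ s / (Q s : ℂ)) (Ioi r))
    (hi₂ : IntegrableOn (fun s => ((g s : ℝ) : ℂ)) (Ioi r))
    (hrep : ε r = -((Q r : ℝ) : ℂ) * ((∫ s in Ioi r, ε₁ s / (Q s : ℂ))
      + (∫ s in Ioi r, ((g s : ℝ) : ℂ)) + ∫ s in Ioi r, ((g s / Q s : ℝ) : ℂ) * ε s)) :
    ‖ε r / (Real.sinh r : ℂ)‖ₑ ≤ ENNReal.ofReal B * (ENNReal.ofReal (1 / Real.cosh r) *
      ∫⁻ s in Ioi r, (‖ε₁ s‖ₑ + (ENNReal.ofReal C + M) * ‖g s‖ₑ)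
        * ENNReal.ofReal (Real.cosh s / Real.sinh s)) := by
  set f : ℝ → ℝ≥0∞ := fun s => ‖ε₁ s‖ₑ + (ENNReal.ofReal C + M) * ‖g s‖ₑ with hf
  have hMr : ∀ᵐ s ∂volume.restrict (Ioi r), ‖ε s‖ₑ ≤ M :=
    ae_mono (Measure.restrict_mono (Ioi_subset_Ioi hr.le) le_rfl) hM
  have hsr : 0 < Real.sinh r := Real.sinh_pos_iff.2 hr
  have hnorm : ∀ x : ℝ, ‖(x : ℂ)‖ₑ = ‖x‖ₑ := fun x => by
    rw [← ofReal_norm, ← ofReal_norm, Complex.norm_real]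
  have hsum : ‖(∫ s in Ioi r, ε₁ s / (Q s : ℂ))
      + (∫ s in Ioi r, ((g s : ℝ) : ℂ)) + ∫ s in Ioi r, ((g s / Q s : ℝ) : ℂ) * ε s‖ₑ
      ≤ ∫⁻ s in Ioi r, f s * ENNReal.ofReal (1 / Q s) := by
    calc _ ≤ (∫⁻ s in Ioi r, ‖ε₁ s / (Q s : ℂ)‖ₑ) + (∫⁻ s in Ioi r, ‖((g s : ℝ) : ℂ)‖ₑ)
          + ∫⁻ s in Ioi r, ‖((g s / Q s : ℝ) : ℂ) * ε s‖ₑ :=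
          (enorm_add_le _ _).trans (add_le_add ((enorm_add_le _ _).trans (add_le_add
            (enorm_integral_le_lintegral_enorm _) (enorm_integral_le_lintegral_enorm _)))
            (enorm_integral_le_lintegral_enorm _))
      _ = ∫⁻ s in Ioi r, (‖ε₁ s / (Q s : ℂ)‖ₑ + ‖((g s : ℝ) : ℂ)‖ₑ
          + ‖((g s / Q s : ℝ) : ℂ) * ε s‖ₑ) := by
          rw [lintegral_add_left', lintegral_add_left']
          · exact hi₁.aestronglyMeasurable.enorm
          · exact hi₁.aestronglyMeasurable.enorm.add hi₂.aestronglyMeasurable.enorm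
      _ ≤ _ := by
          refine lintegral_mono_ae ?_
          filter_upwards [hMr, ae_restrict_mem measurableSet_Ioi] with s hs hs0
          have hs0' : s ∈ Ioi (0:ℝ) := hr.trans hs0
          have hq := hQpos s hs0'
          have hinv : ‖(Q s : ℂ)⁻¹‖ₑ = ENNReal.ofReal (1 / Q s) := by
            rw [← Complex.ofReal_inv, hnorm, Real.enorm_of_nonneg (inv_pos.2 hq).le, one_div]
          have h1 : ENNReal.ofReal (Q s) * ENNReal.ofReal (1 / Q s) = 1 := by
            rw [← ENNReal.ofReal_mul hq.le, mul_one_div_cancel hq.ne', ENNReal.ofReal_one]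
          have h2 : ‖g s‖ₑ ≤ ENNReal.ofReal C * ‖g s‖ₑ * ENNReal.ofReal (1 / Q s) := by
            calc ‖g s‖ₑ = ENNReal.ofReal (Q s) * ENNReal.ofReal (1 / Q s) * ‖g s‖ₑ := by
                  rw [h1, one_mul]
              _ ≤ ENNReal.ofReal C * ENNReal.ofReal (1 / Q s) * ‖g s‖ₑ := by
                  gcongr; exact hQC s hs0'
              _ = _ := by ring
          have h3 : ‖((g s / Q s : ℝ) : ℂ) * ε s‖ₑ
              ≤ M * ‖g s‖ₑ * ENNReal.ofReal (1 / Q s) := by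
            rw [enorm_mul, Complex.ofReal_div, div_eq_mul_inv, enorm_mul, hinv, hnorm]
            calc _ ≤ ‖g s‖ₑ * ENNReal.ofReal (1 / Q s) * M := by gcongr
              _ = _ := by ring
          rw [div_eq_mul_inv, enorm_mul, hinv, hnorm, hf]
          calc _ ≤ ‖ε₁ s‖ₑ * ENNReal.ofReal (1 / Q s)
                + ENNReal.ofReal C * ‖g s‖ₑ * ENNReal.ofReal (1 / Q s)
                + M * ‖g s‖ₑ * ENNReal.ofReal (1 / Q s) := by gcongr
            _ = _ := by ring
  have hqr := hQpos r hr
  have hcr := Real.cosh_pos r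
  rw [hrep, div_eq_mul_inv, enorm_mul, enorm_mul, enorm_neg, ← Complex.ofReal_inv, hnorm, hnorm,
    Real.enorm_of_nonneg hqr.le, Real.enorm_of_nonneg (inv_pos.2 hsr).le]
  calc _ ≤ ENNReal.ofReal (Q r) * (∫⁻ s in Ioi r, f s * ENNReal.ofReal (1 / Q s))
        * ENNReal.ofReal (Real.sinh r)⁻¹ := by gcongr
    _ = ∫⁻ s in Ioi r, ENNReal.ofReal ((Real.sinh r)⁻¹ * Q r)
        * (f s * ENNReal.ofReal (1 / Q s)) := by
        rw [lintegral_const_mul' _ _ ENNReal.ofReal_ne_top,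
          ENNReal.ofReal_mul (inv_pos.2 hsr).le]
        ring
    _ ≤ ∫⁻ s in Ioi r, ENNReal.ofReal (B * (1 / Real.cosh r))
        * (f s * ENNReal.ofReal (Real.cosh s / Real.sinh s)) := by
        refine setLIntegral_mono_ae' measurableSet_Ioi (Eventually.of_forall fun s hs => ?_)
        rw [mul_left_comm, mul_left_comm _ (f s), ← ENNReal.ofReal_mul (by positivity),
          ← ENNReal.ofReal_mul (by positivity)]
        refine mul_le_mul' le_rfl (ENNReal.ofReal_le_ofReal ?_)
        calc (Real.sinh r)⁻¹ * Q r * (1 / Q s) = (Real.sinh r)⁻¹ * (Q r / Q s) := by ring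
          _ ≤ (Real.sinh r)⁻¹ *
              (B * (Real.sinh r / Real.cosh r * (Real.cosh s / Real.sinh s))) := by
              gcongr; exact hQ s hs
          _ = _ := by field_simp
    _ = _ := by
        rw [lintegral_const_mul' _ _ ENNReal.ofReal_ne_top, ENNReal.ofReal_mul hB, mul_assoc]

/-- **Control of `‖ε/sinh r‖` and `‖∂_r ε‖` by `ε₁`.** -/
theorem eps_over_sinh_and_deriv_Lp_control
    (m : ℕ) (hm : 1 ≤ m)
    (Q : ℝ → ℝ) (hQcont : ContinuousOn Q (Set.Ioi 0))
    (c C_Q : ℝ) (hc : 0 < c) (hcC : c ≤ C_Q)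
    (hQlb : ∀ r ∈ Set.Ioi (0:ℝ), c * min (r ^ m) 1 ≤ Q r)
    (hQub : ∀ r ∈ Set.Ioi (0:ℝ), Q r ≤ C_Q * min (r ^ m) 1)
    (A : ℝ → ℝ) (hA : ∀ r ∈ Set.Ioi (0:ℝ), 0 ≤ (m:ℝ) - A r ∧ (m:ℝ) - A r ≤ m) :
    ∀ p : ℝ, 2 ≤ p →
    ∃ C > (0:ℝ), ∀ (g : ℝ → ℝ) (ε ε₁ : ℝ → ℂ),
      Measurable g →
      ContDiffOn ℝ 1 ε (Set.Ioi 0) → ContDiffOn ℝ 1 ε₁ (Set.Ioi 0) →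
      wLp p ε₁ < ⊤ → wLp p g < ⊤ → wLinf ε < ⊤ →
      -- absolute convergence of the integrals in the representation of ε
      (∀ r ∈ Set.Ioi (0:ℝ),
        IntegrableOn (fun s => ε₁ s / (Q s : ℂ)) (Set.Ioi r)) →
      (∀ r ∈ Set.Ioi (0:ℝ),
        IntegrableOn (fun s => ((g s : ℝ) : ℂ)) (Set.Ioi r)) →
      (∀ r ∈ Set.Ioi (0:ℝ),
        IntegrableOn (fun s => ((g s / Q s : ℝ) : ℂ) * ε s) (Set.Ioi r)) →
      -- the integral representation of ε
      (∀ r ∈ Set.Ioi (0:ℝ),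
        ε r = -((Q r : ℝ) : ℂ) *
          ((∫ s in Set.Ioi r, ε₁ s / (Q s : ℂ))
            + (∫ s in Set.Ioi r, ((g s : ℝ) : ℂ))
            + ∫ s in Set.Ioi r, ((g s / Q s : ℝ) : ℂ) * ε s)) →
      -- the equation for ∂_r ε
      (∀ r ∈ Set.Ioi (0:ℝ),
        deriv ε r = ε₁ r - (((A r - m) / Real.sinh r : ℝ) : ℂ) * ε r
          - ((g r : ℝ) : ℂ) * (((Q r : ℝ) : ℂ) + ε r)) →
      wLp p (fun r => ε r / (Real.sinh r : ℂ))
          ≤ ENNReal.ofReal C * (wLp p ε₁ + (1 + wLinf ε) * wLp p g) ∧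
      wLp p (deriv ε)
          ≤ ENNReal.ofReal C * (wLp p ε₁ + (1 + wLinf ε) * wLp p g) := by
  intro p hp
  have hp0 : 0 < p := by linarith
  have hp1 : 0 < p - 1 := by linarith
  have hCQ : 0 < C_Q := hc.trans_le hcC
  have hQpos : ∀ s ∈ Ioi (0:ℝ), 0 < Q s := fun s hs =>
    (mul_pos hc (lt_min (pow_pos hs m) one_pos)).trans_le (hQlb s hs)
  have hQC : ∀ s ∈ Ioi (0:ℝ), Q s ≤ C_Q := fun s hs =>
    (hQub s hs).trans (mul_le_of_le_one_right hCQ.le (min_le_right _ _))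
  set B : ℝ := 2 * C_Q / c with hBdef
  have hB : 0 < B := by positivity
  set H : ℝ := ((p - 1) ^ (p - 1)) ^ (1 / p) with hHdef
  have hH : 0 < H := by positivity
  set D : ℝ := max C_Q 1 with hDdef
  have hD : 0 < D := lt_max_of_lt_right one_pos
  refine ⟨D + (m + 1) * (B * (H * D)), by positivity, ?_⟩
  intro g ε ε₁ hg hε hε₁ _ _ hM hi₁ hi₂ _ hrep hder
  set M := wLinf ε with hMdef
  have hMae : ∀ᵐ s ∂volume.restrict (Ioi 0), ‖ε s‖ₑ ≤ M := ENNReal.ae_le_essSup _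
  set f : ℝ → ℝ≥0∞ := fun s => ‖ε₁ s‖ₑ + (ENNReal.ofReal C_Q + M) * ‖g s‖ₑ with hf
  have hmε₁ : AEMeasurable (fun s => ‖ε₁ s‖ₑ) (volume.restrict (Ioi 0)) :=
    (hε₁.continuousOn.aestronglyMeasurable measurableSet_Ioi).enorm
  have hmg : AEMeasurable (fun s => (ENNReal.ofReal C_Q + M) * ‖g s‖ₑ)
      (volume.restrict (Ioi 0)) := (hg.enorm.const_mul _).aemeasurable
  have hmf : AEMeasurable f (volume.restrict (Ioi 0)) := hmε₁.add hmg
  have hmε : AEMeasurable (fun r => ‖ε r / (Real.sinh r : ℂ)‖ₑ) (volume.restrict (Ioi 0)) :=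
    ((hε.continuousOn.aestronglyMeasurable measurableSet_Ioi).aemeasurable.div
      (Complex.measurable_ofReal.comp Real.measurable_sinh).aemeasurable).enorm
  rw [wLp_eq_wNorm, wLp_eq_wNorm, wLp_eq_wNorm, wLp_eq_wNorm]
  set R := wNorm p (fun r => ‖ε₁ r‖ₑ) + (1 + M) * wNorm p (fun r => ‖g r‖ₑ) with hR
  have hKtop : ENNReal.ofReal C_Q + M ≠ ⊤ := ENNReal.add_ne_top.2 ⟨ENNReal.ofReal_ne_top, hM.ne⟩
  have hfR : wNorm p f ≤ ENNReal.ofReal D * R := by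
    have hD1 : 1 ≤ ENNReal.ofReal D := ENNReal.one_le_ofReal.2 (le_max_right _ _)
    have hDC : ENNReal.ofReal C_Q ≤ ENNReal.ofReal D :=
      ENNReal.ofReal_le_ofReal (le_max_left _ _)
    calc wNorm p f ≤ wNorm p (fun r => ‖ε₁ r‖ₑ)
          + (ENNReal.ofReal C_Q + M) * wNorm p (fun r => ‖g r‖ₑ) := by
          rw [← wNorm_const_mul hp0 hKtop]
          exact wNorm_add_le (by linarith) hmε₁ hmg
      _ ≤ ENNReal.ofReal D * wNorm p (fun r => ‖ε₁ r‖ₑ)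
          + (ENNReal.ofReal D + ENNReal.ofReal D * M) * wNorm p (fun r => ‖g r‖ₑ) :=
          add_le_add (le_mul_of_one_le_left' hD1)
            (mul_le_mul' (add_le_add hDC (le_mul_of_one_le_left' hD1)) le_rfl)
      _ = _ := by rw [hR]; ring
  have hquot : wNorm p (fun r => ‖ε r / (Real.sinh r : ℂ)‖ₑ)
      ≤ ENNReal.ofReal (B * (H * D)) * R := by
    calc _ ≤ wNorm p (fun r => ENNReal.ofReal B * (ENNReal.ofReal (1 / Real.cosh r) *
          ∫⁻ s in Ioi r, f s * ENNReal.ofReal (Real.cosh s / Real.sinh s))) := by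
          refine wNorm_mono_ae hp0 (ae_restrict_of_forall_mem measurableSet_Ioi fun r hr => ?_)
          exact enorm_div_sinh_le hB.le hr hQpos hQC
            (fun s hs => div_le_of_comparable_min_pow hm hc hcC hQlb hQub hr (le_of_lt hs))
            hMae (hi₁ r hr) (hi₂ r hr) (hrep r hr)
      _ ≤ ENNReal.ofReal B * (ENNReal.ofReal H * (ENNReal.ofReal D * R)) := by
          rw [wNorm_const_mul hp0 ENNReal.ofReal_ne_top]
          exact mul_le_mul' le_rfl ((wNorm_hardy hp hmf).trans (mul_le_mul' le_rfl hfR))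
      _ = _ := by
          rw [ENNReal.ofReal_mul hB.le, ENNReal.ofReal_mul hH.le]; ring
  refine ⟨hquot.trans (mul_le_mul' (ENNReal.ofReal_le_ofReal ?_) le_rfl), ?_⟩
  · have h1 : 0 ≤ (m : ℝ) * (B * (H * D)) := by positivity
    linarith
  have hnorm : ∀ x : ℝ, ‖(x : ℂ)‖ₑ = ‖x‖ₑ := fun x => by
    rw [← ofReal_norm, ← ofReal_norm, Complex.norm_real]
  calc _ ≤ wNorm p (fun r => f r + ENNReal.ofReal m * ‖ε r / (Real.sinh r : ℂ)‖ₑ) := by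
        refine wNorm_mono_ae hp0 ?_
        filter_upwards [hMae, ae_restrict_mem measurableSet_Ioi] with r hrM hr
        have h1 : ‖(((A r - m) / Real.sinh r : ℝ) : ℂ) * ε r‖ₑ
            ≤ ENNReal.ofReal m * ‖ε r / (Real.sinh r : ℂ)‖ₑ := by
          rw [Complex.ofReal_div, div_mul_eq_mul_div, mul_div_assoc, enorm_mul, hnorm]
          refine mul_le_mul' ?_ le_rfl
          rw [← ofReal_norm, Real.norm_eq_abs]
          refine ENNReal.ofReal_le_ofReal (abs_le.2 ⟨?_, ?_⟩) <;> linarith [hA r hr]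
        have h2 : ‖((g r : ℝ) : ℂ) * (((Q r : ℝ) : ℂ) + ε r)‖ₑ
            ≤ (ENNReal.ofReal C_Q + M) * ‖g r‖ₑ := by
          rw [enorm_mul, hnorm, mul_comm]
          refine mul_le_mul' ((enorm_add_le _ _).trans (add_le_add ?_ hrM)) le_rfl
          rw [hnorm, Real.enorm_of_nonneg (hQpos r hr).le]
          exact ENNReal.ofReal_le_ofReal (hQC r hr)
        rw [hder r hr, hf]
        calc _ ≤ ‖ε₁ r‖ₑ + ‖(((A r - m) / Real.sinh r : ℝ) : ℂ) * ε r‖ₑ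
              + ‖((g r : ℝ) : ℂ) * (((Q r : ℝ) : ℂ) + ε r)‖ₑ :=
              enorm_sub_le.trans <| add_le_add enorm_sub_le le_rfl
          _ ≤ ‖ε₁ r‖ₑ + ENNReal.ofReal m * ‖ε r / (Real.sinh r : ℂ)‖ₑ
              + (ENNReal.ofReal C_Q + M) * ‖g r‖ₑ := by gcongr
          _ = _ := by ring
    _ ≤ wNorm p f + ENNReal.ofReal m * wNorm p (fun r => ‖ε r / (Real.sinh r : ℂ)‖ₑ) := by
        rw [← wNorm_const_mul hp0 ENNReal.ofReal_ne_top]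
        exact wNorm_add_le (by linarith) hmf (hmε.const_mul _)
    _ ≤ ENNReal.ofReal D * R + ENNReal.ofReal m * (ENNReal.ofReal (B * (H * D)) * R) :=
        add_le_add hfR (mul_le_mul' le_rfl hquot)
    _ = ENNReal.ofReal (D + m * (B * (H * D))) * R := by
        rw [ENNReal.ofReal_add hD.le (by positivity),
          ENNReal.ofReal_mul (p := (m : ℝ)) (by positivity)]
        ring
    _ ≤ _ := by
        refine mul_le_mul' (ENNReal.ofReal_le_ofReal ?_) le_rfl
        have h1 : 0 ≤ B * (H * D) := by positivity
        linarith

end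
end

section
/- Smallness of the Darboux-transformed variable: there exist δ₀ > 0 and C > 0 such that if ε ∈ C¹((0,∞),ℂ) satisfies lim_{r→0⁺} ε(r) = 0, ε ∈ L², and ‖ε‖_{H¹_m} ≤ δ with δ ≤ δ₀, then the function ε₁ := ∂_r ε + ((A−m)/sinh r)·ε + (a_θ/sinh r)·(Q + ε) satisfies ‖ε₁‖_{L²} ≤ C δ. -/
/- Smallness of the Darboux-transformed variable ε₁ in terms of ‖ε‖_{H¹_m}. -/

open MeasureTheory Set Filter
open scoped ENNReal NNReal Topology

noncomputable section

/-- Weighted `H¹_m` norm: `‖∂_r F‖_{L²} + ‖F / sinh r‖_{L²}`. -/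
def wH1m (F : ℝ → ℂ) : ℝ≥0∞ :=
  wLp 2 (deriv F) + wLp 2 (fun r => F r / (Real.sinh r : ℂ))

/-- The Darboux-transformed variable
`ε₁ = ∂_r ε + ((A−m)/sinh r)ε + (a_θ/sinh r)(Q+ε)`. -/
def eps1 (m : ℕ) (Q A : ℝ → ℝ) (ε : ℝ → ℂ) (r : ℝ) : ℂ :=
  deriv ε r + (((A r - m) / Real.sinh r : ℝ) : ℂ) * ε r
    + ((atheta Q ε r / Real.sinh r : ℝ) : ℂ) * (((Q r : ℝ) : ℂ) + ε r)

lemma cosh_sub_one_le_sinh {x : ℝ} (hx : 0 ≤ x) : Real.cosh x - 1 ≤ Real.sinh x := by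
  have h := Real.cosh_sub_sinh x
  have : Real.exp (-x) ≤ 1 := Real.exp_le_one_iff.2 (by linarith)
  linarith

lemma wLp_two_eq {E : Type*} [NormedAddCommGroup E] (F : ℝ → E) :
    wLp 2 F = (∫⁻ r in Ioi (0:ℝ), ENNReal.ofReal (‖F r‖ ^ 2 * Real.sinh r)) ^ (1 / (2:ℝ)) := by
  unfold wLp
  congr 1
  refine lintegral_congr fun r => ?_
  rw [ENNReal.ofReal_mul (by positivity), ENNReal.ofReal_pow (norm_nonneg _),
    ofReal_norm]
  norm_cast

lemma ae_Ioi_sq_mul_sinh_nonneg {E : Type*} [NormedAddCommGroup E] (F : ℝ → E) :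
    0 ≤ᵐ[volume.restrict (Ioi (0:ℝ))] fun r => ‖F r‖ ^ 2 * Real.sinh r := by
  filter_upwards [ae_restrict_mem measurableSet_Ioi] with r hr
  have : 0 < Real.sinh r := Real.sinh_pos_iff.2 hr
  simp only [Pi.zero_apply]
  positivity

lemma integrableOn_of_wLp_two_lt_top {E : Type*} [NormedAddCommGroup E] {F : ℝ → E}
    (hF : AEStronglyMeasurable F (volume.restrict (Ioi (0:ℝ)))) (h : wLp 2 F < ⊤) :
    IntegrableOn (fun r => ‖F r‖ ^ 2 * Real.sinh r) (Ioi 0) := by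
  refine ⟨(hF.norm.pow 2).mul Real.continuous_sinh.aestronglyMeasurable, ?_⟩
  rw [hasFiniteIntegral_iff_ofReal (ae_Ioi_sq_mul_sinh_nonneg F)]
  rw [wLp_two_eq] at h
  by_contra hc
  rw [not_lt_top_iff.1 hc, ENNReal.top_rpow_of_pos (by norm_num)] at h
  exact lt_irrefl _ h

lemma setIntegral_le_of_wLp_two_le {E : Type*} [NormedAddCommGroup E] {F : ℝ → E} {δ : ℝ}
    (hδ : 0 ≤ δ) (hF : AEStronglyMeasurable F (volume.restrict (Ioi (0:ℝ))))
    (h : wLp 2 F ≤ ENNReal.ofReal δ) :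
    IntegrableOn (fun r => ‖F r‖ ^ 2 * Real.sinh r) (Ioi 0) ∧
      ∫ r in Ioi (0:ℝ), ‖F r‖ ^ 2 * Real.sinh r ≤ δ ^ 2 := by
  have hi := integrableOn_of_wLp_two_lt_top hF (h.trans_lt ENNReal.ofReal_lt_top)
  refine ⟨hi, ?_⟩
  rw [wLp_two_eq, ← ofReal_integral_eq_lintegral_ofReal hi (ae_Ioi_sq_mul_sinh_nonneg F),
    ENNReal.ofReal_rpow_of_nonneg (integral_nonneg_of_ae (ae_Ioi_sq_mul_sinh_nonneg F))
      (by norm_num), ENNReal.ofReal_le_ofReal_iff hδ, ← Real.sqrt_eq_rpow,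
    Real.sqrt_le_left hδ] at h
  exact h

lemma wLp_two_le_of_sq_le {E : Type*} [NormedAddCommGroup E] {F : ℝ → E} {H : ℝ → ℝ} {δ : ℝ}
    (hδ : 0 ≤ δ) (hH : IntegrableOn H (Ioi 0))
    (hFH : ∀ r ∈ Ioi (0:ℝ), ‖F r‖ ^ 2 * Real.sinh r ≤ H r)
    (hHδ : ∫ r in Ioi (0:ℝ), H r ≤ δ ^ 2) : wLp 2 F ≤ ENNReal.ofReal δ := by
  have hH0 : 0 ≤ᵐ[volume.restrict (Ioi (0:ℝ))] H := by
    filter_upwards [ae_restrict_mem measurableSet_Ioi, ae_Ioi_sq_mul_sinh_nonneg F] with r hr h0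
    exact h0.trans (hFH r hr)
  rw [wLp_two_eq]
  calc _ ≤ (ENNReal.ofReal (δ ^ 2)) ^ (1 / (2:ℝ)) := by
        gcongr
        refine (setLIntegral_mono' measurableSet_Ioi
          fun r hr => ENNReal.ofReal_le_ofReal (hFH r hr)).trans ?_
        rw [← ofReal_integral_eq_lintegral_ofReal hH hH0]
        exact ENNReal.ofReal_le_ofReal hHδ
    _ = ENNReal.ofReal δ := by
        rw [ENNReal.ofReal_rpow_of_nonneg (by positivity) (by norm_num), ← Real.sqrt_eq_rpow,
          Real.sqrt_sq hδ]

lemma abs_two_mul_inner_le (z w : ℂ) {c : ℝ} (hc : 0 < c) :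
    |2 * inner ℝ z w| ≤ c * ‖z‖ ^ 2 + c⁻¹ * ‖w‖ ^ 2 := by
  have h1 := abs_real_inner_le_norm z w
  have h2 : c * ‖z‖ ^ 2 + c⁻¹ * ‖w‖ ^ 2 - 2 * (‖z‖ * ‖w‖) = c⁻¹ * (c * ‖z‖ - ‖w‖) ^ 2 := by
    field_simp
    ring
  have h3 : 0 ≤ c⁻¹ * (c * ‖z‖ - ‖w‖) ^ 2 := by positivity
  rw [abs_mul, abs_two]
  linarith

/-- Poincaré inequality for radial functions on the hyperbolic plane. -/
lemma setIntegral_sq_mul_sinh_le {ε ε' : ℝ → ℂ}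
    (hd : ∀ r ∈ Ioi (0:ℝ), HasDerivAt ε (ε' r) r)
    (hε' : AEStronglyMeasurable ε' (volume.restrict (Ioi (0:ℝ))))
    (h0 : Tendsto ε (𝓝[>] (0:ℝ)) (𝓝 0))
    (hi : IntegrableOn (fun r => ‖ε r‖ ^ 2 * Real.sinh r) (Ioi 0))
    (hi' : IntegrableOn (fun r => ‖ε' r‖ ^ 2 * Real.sinh r) (Ioi 0)) :
    ∫ r in Ioi (0:ℝ), ‖ε r‖ ^ 2 * Real.sinh r
      ≤ 4 * ∫ r in Ioi (0:ℝ), ‖ε' r‖ ^ 2 * Real.sinh r := by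
  have hc : ContinuousOn ε (Ioi 0) := fun r hr => (hd r hr).continuousAt.continuousWithinAt
  have hm : AEStronglyMeasurable ε (volume.restrict (Ioi (0:ℝ))) :=
    hc.aestronglyMeasurable measurableSet_Ioi
  have hw : Continuous fun r : ℝ => Real.cosh r - 1 := by fun_prop
  have hbd : ∀ r ∈ Ioi (0:ℝ), |2 * inner ℝ (ε r) (ε' r) * (Real.cosh r - 1)|
      ≤ (1 / 2) * (‖ε r‖ ^ 2 * Real.sinh r) + 2 * (‖ε' r‖ ^ 2 * Real.sinh r) := by
    intro r hr
    have h1 := abs_two_mul_inner_le (ε r) (ε' r) (c := 1 / 2) (by norm_num)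
    have h2 := cosh_sub_one_le_sinh (le_of_lt hr)
    have h3 : 0 ≤ Real.cosh r - 1 := by linarith [Real.one_le_cosh r]
    rw [abs_mul, abs_of_nonneg h3]
    calc _ ≤ (1 / 2 * ‖ε r‖ ^ 2 + (1 / 2)⁻¹ * ‖ε' r‖ ^ 2) * Real.sinh r := by gcongr
      _ = _ := by ring
  have hbi := (hi.const_mul (1 / 2)).add (hi'.const_mul 2)
  have hI1 : IntegrableOn (fun r => 2 * inner ℝ (ε r) (ε' r) * (Real.cosh r - 1)) (Ioi 0) := by
    refine hbi.mono' (((hm.inner hε').const_mul 2).mul hw.aestronglyMeasurable) ?_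
    filter_upwards [ae_restrict_mem measurableSet_Ioi] with r hr using hbd r hr
  have hI2 : IntegrableOn (fun r => ‖ε r‖ ^ 2 * (Real.cosh r - 1)) (Ioi 0) := by
    refine hi.mono' ((hm.norm.pow 2).mul hw.aestronglyMeasurable) ?_
    filter_upwards [ae_restrict_mem measurableSet_Ioi] with r hr
    have h3 : 0 ≤ Real.cosh r - 1 := by linarith [Real.one_le_cosh r]
    rw [Real.norm_of_nonneg (by positivity)]
    gcongr
    exact cosh_sub_one_le_sinh (le_of_lt hr)
  have hder : ∀ r ∈ Ioi (0:ℝ), HasDerivAt (fun r => ‖ε r‖ ^ 2 * (Real.cosh r - 1))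
      (2 * inner ℝ (ε r) (ε' r) * (Real.cosh r - 1) + ‖ε r‖ ^ 2 * Real.sinh r) r :=
    fun r hr => (hd r hr).norm_sq.mul ((Real.hasDerivAt_cosh r).sub_const 1)
  have hI3 := hI1.add hi
  have hlim := tendsto_zero_of_hasDerivAt_of_integrableOn_Ioi hder hI3 hI2
  have hcont : ContinuousWithinAt (fun r => ‖ε r‖ ^ 2 * (Real.cosh r - 1)) (Ici 0) 0 := by
    rw [← continuousWithinAt_Ioi_iff_Ici]
    have h1 := (h0.norm.pow 2).mul (hw.continuousWithinAt (s := Ioi 0) (x := 0)).tendsto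
    simpa [ContinuousWithinAt] using h1
  have hint := integral_Ioi_of_hasDerivAt_of_tendsto hcont hder hI3 hlim
  rw [integral_add hI1 hi] at hint
  simp only [Real.cosh_zero, sub_self, mul_zero] at hint
  have hle : -∫ r in Ioi (0:ℝ), 2 * inner ℝ (ε r) (ε' r) * (Real.cosh r - 1)
      ≤ ∫ r in Ioi (0:ℝ), ((1 / 2) * (‖ε r‖ ^ 2 * Real.sinh r)
        + 2 * (‖ε' r‖ ^ 2 * Real.sinh r)) := by
    rw [← integral_neg]
    exact setIntegral_mono_on hI1.neg hbi measurableSet_Ioi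
      fun r hr => (neg_le_abs _).trans (hbd r hr)
  rw [integral_add (hi.const_mul _) (hi'.const_mul _), integral_const_mul,
    integral_const_mul] at hle
  linarith

lemma sq_norm_le_of_weighted_bounds {ε ε' : ℝ → ℂ}
    (hd : ∀ r ∈ Ioi (0:ℝ), HasDerivAt ε (ε' r) r)
    (hε' : AEStronglyMeasurable ε' (volume.restrict (Ioi (0:ℝ))))
    (h0 : Tendsto ε (𝓝[>] (0:ℝ)) (𝓝 0))
    (hi : IntegrableOn (fun r => ‖ε r / (Real.sinh r : ℂ)‖ ^ 2 * Real.sinh r) (Ioi 0))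
    (hi' : IntegrableOn (fun r => ‖ε' r‖ ^ 2 * Real.sinh r) (Ioi 0)) {r : ℝ} (hr : 0 < r) :
    ‖ε r‖ ^ 2 ≤ (∫ r in Ioi (0:ℝ), ‖ε r / (Real.sinh r : ℂ)‖ ^ 2 * Real.sinh r)
      + ∫ r in Ioi (0:ℝ), ‖ε' r‖ ^ 2 * Real.sinh r := by
  have hc : ContinuousOn ε (Ioi 0) := fun r hr => (hd r hr).continuousAt.continuousWithinAt
  have hm : AEStronglyMeasurable ε (volume.restrict (Ioi (0:ℝ))) :=
    hc.aestronglyMeasurable measurableSet_Ioi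
  have hbd : ∀ s ∈ Ioi (0:ℝ), |2 * inner ℝ (ε s) (ε' s)|
      ≤ ‖ε s / (Real.sinh s : ℂ)‖ ^ 2 * Real.sinh s + ‖ε' s‖ ^ 2 * Real.sinh s := by
    intro s hs
    have hsp : 0 < Real.sinh s := Real.sinh_pos_iff.2 hs
    have h1 := abs_two_mul_inner_le (ε s) (ε' s) (inv_pos.2 hsp)
    rw [norm_div, Complex.norm_real, Real.norm_of_nonneg hsp.le]
    refine h1.trans_eq ?_
    field_simp
  have hbi := hi.add hi'
  have hI : IntegrableOn (fun s => 2 * inner ℝ (ε s) (ε' s)) (Ioi 0) := by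
    refine hbi.mono' ((hm.inner hε').const_mul 2) ?_
    filter_upwards [ae_restrict_mem measurableSet_Ioi] with s hs using hbd s hs
  have hftc := intervalIntegral.integral_eq_sub_of_hasDerivAt_of_tendsto hr
    (f := fun s => ‖ε s‖ ^ 2) (f' := fun s => 2 * inner ℝ (ε s) (ε' s)) (fa := 0)
    (fb := ‖ε r‖ ^ 2) (fun s hs => (hd s hs.1).norm_sq)
    ((intervalIntegrable_iff_integrableOn_Ioc_of_le hr.le).2 (hI.mono_set Ioc_subset_Ioi_self))
    (by simpa using h0.norm.pow 2)
    ((((hd r hr).continuousAt.norm.pow 2).continuousWithinAt).tendsto)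
  rw [sub_zero, intervalIntegral.integral_of_le hr.le] at hftc
  rw [← hftc, ← integral_add hi hi']
  calc _ ≤ ∫ s in Ioc 0 r, (‖ε s / (Real.sinh s : ℂ)‖ ^ 2 * Real.sinh s
          + ‖ε' s‖ ^ 2 * Real.sinh s) :=
        setIntegral_mono_on (hI.mono_set Ioc_subset_Ioi_self)
          (hbi.mono_set Ioc_subset_Ioi_self) measurableSet_Ioc
          fun s hs => (le_abs_self _).trans (hbd s hs.1)
    _ ≤ _ := by
        refine setIntegral_mono_set hbi ?_ Ioc_subset_Ioi_self.eventuallyLE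
        filter_upwards [ae_restrict_mem measurableSet_Ioi] with s hs
        exact (abs_nonneg _).trans (hbd s hs)

lemma integrableOn_Ioc_mul_sinh {g : ℝ → ℝ} (hg : ContinuousOn g (Ioi 0))
    (h1 : ∀ r ∈ Ioi (0:ℝ), |g r| ≤ 1) (r : ℝ) :
    IntegrableOn (fun s => g s * Real.sinh s) (Ioc 0 r) := by
  refine Integrable.mono' (g := Real.sinh) (Real.continuous_sinh.integrableOn_Ioc)
    (((hg.mono Ioc_subset_Ioi_self).aestronglyMeasurable measurableSet_Ioc).mul
      Real.continuous_sinh.aestronglyMeasurable) ?_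
  filter_upwards [ae_restrict_mem measurableSet_Ioc] with s hs
  have h3 : 0 < Real.sinh s := Real.sinh_pos_iff.2 hs.1
  rw [norm_mul, Real.norm_of_nonneg h3.le]
  exact mul_le_of_le_one_left h3.le (h1 s hs.1)

/-- Hardy inequality for the averaging operator associated with the measure `sinh r dr`. -/
lemma setIntegral_sq_primitive_div_sinh_le {g : ℝ → ℝ} (hg : ContinuousOn g (Ioi 0))
    (hg0 : ∀ r ∈ Ioi (0:ℝ), 0 ≤ g r) (hg1 : ∀ r ∈ Ioi (0:ℝ), g r ≤ 1)
    (hi : IntegrableOn (fun r => g r ^ 2 * Real.sinh r) (Ioi 0)) :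
    IntegrableOn (fun r => (∫ s in Ioc 0 r, g s * Real.sinh s) ^ 2 / Real.sinh r) (Ioi 0) ∧
      ∫ r in Ioi (0:ℝ), (∫ s in Ioc 0 r, g s * Real.sinh s) ^ 2 / Real.sinh r
        ≤ 4 * ∫ r in Ioi (0:ℝ), g r ^ 2 * Real.sinh r := by
  set G : ℝ → ℝ := fun r => ∫ s in Ioc 0 r, g s * Real.sinh s with hG
  change IntegrableOn (fun r => G r ^ 2 / Real.sinh r) (Ioi 0) ∧
    ∫ r in Ioi (0:ℝ), G r ^ 2 / Real.sinh r ≤ _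
  have hsp : ∀ {r : ℝ}, r ∈ Ioi (0:ℝ) → 0 < Real.sinh r := fun hr => Real.sinh_pos_iff.2 hr
  have hgi := integrableOn_Ioc_mul_sinh hg fun r hr => abs_le.2 ⟨by linarith [hg0 r hr], hg1 r hr⟩
  have hG0 : ∀ r, 0 ≤ G r := fun r => setIntegral_nonneg measurableSet_Ioc
    fun s hs => mul_nonneg (hg0 s hs.1) (hsp hs.1).le
  have hG1 : ∀ r ∈ Ioi (0:ℝ), G r ≤ r * Real.sinh r := by
    intro r hr
    have h := norm_setIntegral_le_of_norm_le_const (μ := volume) (s := Ioc 0 r)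
      (f := fun s => g s * Real.sinh s) (C := Real.sinh r) (by simp) (fun s hs => by
        rw [Real.norm_of_nonneg (mul_nonneg (hg0 s hs.1) (hsp hs.1).le)]
        exact (mul_le_of_le_one_left (hsp hs.1).le (hg1 s hs.1)).trans
          (Real.sinh_le_sinh.2 hs.2))
    rw [Real.volume_real_Ioc_of_le (le_of_lt hr)] at h
    linarith [le_abs_self (G r), Real.norm_eq_abs (G r)]
  have hGd : ∀ r ∈ Ioi (0:ℝ), HasDerivAt G (g r * Real.sinh r) r := by
    intro r hr
    have hgc : ContinuousOn (fun s => g s * Real.sinh s) (Ioi 0) :=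
      hg.mul Real.continuous_sinh.continuousOn
    have h := intervalIntegral.integral_hasDerivAt_right
      ((intervalIntegrable_iff_integrableOn_Ioc_of_le (le_of_lt hr)).2 (hgi r))
      (hgc.stronglyMeasurableAtFilter isOpen_Ioi r hr) (hgc.continuousAt (Ioi_mem_nhds hr))
    refine h.congr_of_eventuallyEq ?_
    filter_upwards [Ioi_mem_nhds hr] with s hs
    exact (intervalIntegral.integral_of_le (le_of_lt hs)).symm
  have hGc : ContinuousOn G (Ioi 0) := fun r hr => (hGd r hr).continuousAt.continuousWithinAt
  have hne : ∀ r ∈ Ioi (0:ℝ), Real.sinh r ≠ 0 := fun r hr => (hsp hr).ne'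
  have hsc : ContinuousOn Real.sinh (Ioi 0) := Real.continuous_sinh.continuousOn
  have hcc : ContinuousOn Real.cosh (Ioi 0) := Real.continuous_cosh.continuousOn
  have hint : ∀ {f : ℝ → ℝ} {b : ℝ → ℝ}, ContinuousOn f (Ioi 0) → Continuous b →
      (∀ r ∈ Ioi (0:ℝ), 0 ≤ f r ∧ f r ≤ b r) → ∀ R, IntegrableOn f (Ioc 0 R) := by
    intro f b hf hb hfb R
    refine hb.integrableOn_Ioc.mono'
      ((hf.mono Ioc_subset_Ioi_self).aestronglyMeasurable measurableSet_Ioc) ?_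
    filter_upwards [ae_restrict_mem measurableSet_Ioc] with s hs
    rw [Real.norm_of_nonneg (hfb s hs.1).1]
    exact (hfb s hs.1).2
  have hsq : ∀ r ∈ Ioi (0:ℝ), G r ^ 2 / Real.sinh r ≤ r ^ 2 * Real.sinh r := by
    intro r hr
    rw [div_le_iff₀ (hsp hr)]
    calc G r ^ 2 ≤ (r * Real.sinh r) ^ 2 := pow_le_pow_left₀ (hG0 r) (hG1 r hr) 2
      _ = _ := by ring
  have hi1 : ∀ R, IntegrableOn (fun r => G r ^ 2 / Real.sinh r) (Ioc 0 R) :=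
    hint (b := fun r => r ^ 2 * Real.sinh r) ((hGc.pow 2).div hsc hne) (by fun_prop)
      fun r hr => ⟨div_nonneg (sq_nonneg _) (hsp hr).le, hsq r hr⟩
  have hi2 : ∀ R, IntegrableOn (fun r => G r ^ 2 / Real.sinh r * (Real.cosh r / Real.sinh r))
      (Ioc 0 R) :=
    hint (b := fun r => r ^ 2 * Real.cosh r)
      (((hGc.pow 2).div hsc hne).mul (hcc.div hsc hne)) (by fun_prop)
      fun r hr => ⟨by have := hsp hr; have := Real.cosh_pos r; positivity, by
        have h1 := hsp hr
        have h2 := Real.cosh_pos r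
        calc _ ≤ r ^ 2 * Real.sinh r * (Real.cosh r / Real.sinh r) := by
              gcongr; exact hsq r hr
          _ = _ := by field_simp⟩
  have hi3 : ∀ R, IntegrableOn (fun r => 2 * G r * g r) (Ioc 0 R) :=
    hint (b := fun r => 2 * (|r| * |Real.sinh r|)) ((continuousOn_const.mul hGc).mul hg)
      (by fun_prop) fun r hr => ⟨by have := hG0 r; have := hg0 r hr; positivity, by
        rw [abs_of_pos hr, abs_of_pos (hsp hr)]
        nlinarith [hG0 r, hG1 r hr, hg0 r hr, hg1 r hr]⟩
  have hder : ∀ r ∈ Ioi (0:ℝ), HasDerivAt (fun r => G r ^ 2 / Real.sinh r)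
      (2 * G r * g r - G r ^ 2 / Real.sinh r * (Real.cosh r / Real.sinh r)) r := by
    intro r hr
    have h := ((hGd r hr).pow 2).div (Real.hasDerivAt_sinh r) (hne r hr)
    refine h.congr_deriv ?_
    have := hne r hr
    simp only [Pi.pow_apply]
    field_simp
    ring
  have hlim : Tendsto (fun r => G r ^ 2 / Real.sinh r) (𝓝[>] 0) (𝓝 0) := by
    have hb : Tendsto (fun r : ℝ => r ^ 2 * Real.sinh r) (𝓝[>] 0) (𝓝 0) := by
      have hcb : Continuous fun r : ℝ => r ^ 2 * Real.sinh r := by fun_prop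
      simpa using (hcb.tendsto 0).mono_left nhdsWithin_le_nhds
    refine tendsto_of_tendsto_of_tendsto_of_le_of_le' tendsto_const_nhds hb ?_ ?_
    · filter_upwards [self_mem_nhdsWithin] with r hr using div_nonneg (sq_nonneg _) (hsp hr).le
    · filter_upwards [self_mem_nhdsWithin] with r hr using hsq r hr
  have hmain : ∀ R ∈ Ioi (0:ℝ), ∫ r in (0:ℝ)..R, G r ^ 2 / Real.sinh r
      ≤ 4 * ∫ r in Ioi (0:ℝ), g r ^ 2 * Real.sinh r := by
    intro R hR
    have hgR := hi.mono_set (Ioc_subset_Ioi_self : Ioc 0 R ⊆ Ioi 0)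
    have hftc := intervalIntegral.integral_eq_sub_of_hasDerivAt_of_tendsto hR
      (fun r hr => hder r hr.1)
      ((intervalIntegrable_iff_integrableOn_Ioc_of_le (le_of_lt hR)).2 ((hi3 R).sub (hi2 R)))
      hlim (hder R hR).continuousAt.continuousWithinAt.tendsto
    rw [intervalIntegral.integral_of_le (le_of_lt hR), integral_sub (hi3 R) (hi2 R)] at hftc
    have hpos : 0 ≤ G R ^ 2 / Real.sinh R := div_nonneg (sq_nonneg _) (hsp hR).le
    have hA : ∫ r in Ioc 0 R, G r ^ 2 / Real.sinh r
        ≤ ∫ r in Ioc 0 R, G r ^ 2 / Real.sinh r * (Real.cosh r / Real.sinh r) := by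
      refine setIntegral_mono_on (hi1 R) (hi2 R) measurableSet_Ioc fun r hr => ?_
      exact le_mul_of_one_le_right (div_nonneg (sq_nonneg _) (hsp hr.1).le)
        ((one_le_div (hsp hr.1)).2 (Real.sinh_lt_cosh r).le)
    have hB : ∫ r in Ioc 0 R, 2 * G r * g r ≤ ∫ r in Ioc 0 R,
        ((1 / 2) * (G r ^ 2 / Real.sinh r) + 2 * (g r ^ 2 * Real.sinh r)) := by
      refine setIntegral_mono_on (hi3 R) (((hi1 R).const_mul _).add (hgR.const_mul _))
        measurableSet_Ioc fun r hr => ?_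
      have hs := hsp hr.1
      have h1 : (1 / 2) * (G r ^ 2 / Real.sinh r) + 2 * (g r ^ 2 * Real.sinh r) - 2 * G r * g r
          = (1 / 2) * ((G r - 2 * g r * Real.sinh r) ^ 2 / Real.sinh r) := by
        field_simp
        ring
      have h2 : 0 ≤ (1 / 2) * ((G r - 2 * g r * Real.sinh r) ^ 2 / Real.sinh r) := by positivity
      linarith
    rw [integral_add ((hi1 R).const_mul _) (hgR.const_mul _), integral_const_mul,
      integral_const_mul] at hB
    have hC : ∫ r in Ioc 0 R, g r ^ 2 * Real.sinh r ≤ ∫ r in Ioi (0:ℝ), g r ^ 2 * Real.sinh r := by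
      refine setIntegral_mono_set hi ?_ Ioc_subset_Ioi_self.eventuallyLE
      filter_upwards [ae_restrict_mem measurableSet_Ioi] with r hr
      exact mul_nonneg (sq_nonneg _) (hsp hr).le
    rw [intervalIntegral.integral_of_le (le_of_lt hR)]
    linarith
  have hI : IntegrableOn (fun r => G r ^ 2 / Real.sinh r) (Ioi 0) := by
    refine integrableOn_Ioi_of_intervalIntegral_norm_bounded
      (4 * ∫ r in Ioi (0:ℝ), g r ^ 2 * Real.sinh r) 0 hi1 tendsto_id ?_
    filter_upwards [Ioi_mem_atTop 0] with R hR
    refine le_trans (le_of_eq ?_) (hmain R hR)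
    rw [intervalIntegral.integral_of_le (le_of_lt hR),
      intervalIntegral.integral_of_le (le_of_lt hR)]
    exact setIntegral_congr_fun measurableSet_Ioc fun r hr =>
      Real.norm_of_nonneg (div_nonneg (sq_nonneg _) (hsp hr.1).le)
  refine ⟨hI, le_of_tendsto (intervalIntegral_tendsto_integral_Ioi 0 hI tendsto_id) ?_⟩
  filter_upwards [Ioi_mem_atTop 0] with R hR using hmain R hR

lemma abs_atheta_le {Q : ℝ → ℝ} {ε : ℝ → ℂ} (hQ0 : ∀ r, 0 ≤ Q r) (hQ1 : ∀ r, Q r ≤ 1)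
    (hε : ContinuousOn ε (Ioi 0)) (hε1 : ∀ r ∈ Ioi (0:ℝ), ‖ε r‖ ≤ 1) (r : ℝ) :
    |atheta Q ε r| ≤ (3 / 2) * ∫ s in Ioc 0 r, ‖ε s‖ * Real.sinh s := by
  have hi := integrableOn_Ioc_mul_sinh hε.norm (fun s hs => by simpa using hε1 s hs) r
  have h1 : |∫ s in Ioc 0 r, Q s * (ε s).re * Real.sinh s|
      ≤ ∫ s in Ioc 0 r, ‖ε s‖ * Real.sinh s := by
    rw [← Real.norm_eq_abs]
    refine norm_integral_le_of_norm_le hi ?_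
    filter_upwards [ae_restrict_mem measurableSet_Ioc] with s hs
    have h3 : 0 < Real.sinh s := Real.sinh_pos_iff.2 hs.1
    rw [norm_mul, norm_mul, Real.norm_of_nonneg h3.le, Real.norm_of_nonneg (hQ0 s)]
    gcongr
    exact (mul_le_of_le_one_left (norm_nonneg _) (hQ1 s)).trans (Complex.abs_re_le_norm _)
  have h2 : |∫ s in Ioc 0 r, ‖ε s‖ ^ 2 * Real.sinh s|
      ≤ ∫ s in Ioc 0 r, ‖ε s‖ * Real.sinh s := by
    rw [← Real.norm_eq_abs]
    refine norm_integral_le_of_norm_le hi ?_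
    filter_upwards [ae_restrict_mem measurableSet_Ioc] with s hs
    have h3 : 0 < Real.sinh s := Real.sinh_pos_iff.2 hs.1
    rw [Real.norm_of_nonneg (by positivity)]
    gcongr
    exact pow_le_of_le_one (norm_nonneg _) (hε1 s hs.1) two_ne_zero
  unfold atheta
  rw [abs_le] at *
  constructor <;> linarith

lemma norm_eps1_le {m : ℕ} {Q A : ℝ → ℝ} {ε : ℝ → ℂ} (hQ0 : ∀ r, 0 ≤ Q r)
    (hQ1 : ∀ r, Q r ≤ 1)
    (hA : ∀ r ∈ Ioi (0:ℝ), 0 ≤ (m:ℝ) - A r ∧ (m:ℝ) - A r ≤ m)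
    (hε : ContinuousOn ε (Ioi 0)) (hε1 : ∀ r ∈ Ioi (0:ℝ), ‖ε r‖ ≤ 1) {r : ℝ} (hr : 0 < r) :
    ‖eps1 m Q A ε r‖ ≤ ‖deriv ε r‖ + m * ‖ε r / (Real.sinh r : ℂ)‖
      + 3 * ((∫ s in Ioc 0 r, ‖ε s‖ * Real.sinh s) / Real.sinh r) := by
  have hs : 0 < Real.sinh r := Real.sinh_pos_iff.2 hr
  have hAr := hA r hr
  have hAm : |A r - m| ≤ m := by rw [abs_le]; constructor <;> linarith
  have hθ := abs_atheta_le hQ0 hQ1 hε hε1 r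
  have hG : 0 ≤ ∫ s in Ioc 0 r, ‖ε s‖ * Real.sinh s := by linarith [abs_nonneg (atheta Q ε r)]
  have hQε : ‖((Q r : ℝ) : ℂ) + ε r‖ ≤ 2 := by
    refine (norm_add_le _ _).trans ?_
    rw [Complex.norm_real, Real.norm_of_nonneg (hQ0 r)]
    linarith [hQ1 r, hε1 r hr]
  refine (norm_add₃_le).trans ?_
  gcongr ?_ + ?_ + ?_
  · rfl
  · rw [norm_mul, norm_div, Complex.norm_real, Complex.norm_real, norm_div,
      Real.norm_of_nonneg hs.le, Real.norm_eq_abs, div_mul_eq_mul_div, mul_div_assoc]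
    gcongr
  · rw [norm_mul, Complex.norm_real, norm_div, Real.norm_of_nonneg hs.le, Real.norm_eq_abs]
    calc _ ≤ (3 / 2 * ∫ s in Ioc 0 r, ‖ε s‖ * Real.sinh s) / Real.sinh r * 2 := by gcongr
      _ = _ := by ring

/-- **Smallness of the Darboux-transformed variable:** if `‖ε‖_{H¹_m} ≤ δ ≤ δ₀`
then `‖ε₁‖_{L²} ≤ Cδ`. -/
theorem eps1_smallness
    (m : ℕ) (hm : 1 ≤ m) (Q A : ℝ → ℝ)
    (hQmeas : Measurable Q) (hQ0 : ∀ r, 0 ≤ Q r) (hQ1 : ∀ r, Q r ≤ 1)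
    (hA : ∀ r ∈ Set.Ioi (0:ℝ), 0 ≤ (m:ℝ) - A r ∧ (m:ℝ) - A r ≤ m) :
    ∃ δ₀ > (0:ℝ), ∃ C > (0:ℝ), ∀ (δ : ℝ) (ε : ℝ → ℂ),
      ContDiffOn ℝ 1 ε (Set.Ioi 0) →
      Tendsto ε (𝓝[>] (0:ℝ)) (𝓝 0) →
      wLp 2 ε < ⊤ →
      wH1m ε ≤ ENNReal.ofReal δ → δ ≤ δ₀ →
      wLp 2 (fun r => eps1 m Q A ε r) ≤ ENNReal.ofReal (C * δ) := by
  refine ⟨1 / 2, by norm_num, 21 * (1 + m), by positivity, ?_⟩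
  intro δ₁ ε hC1 h0 hL2 hH hδ₁
  obtain ⟨δ, hδ, hδ2, hH, hgoal⟩ : ∃ δ : ℝ, 0 ≤ δ ∧ δ ≤ 1 / 2 ∧ wH1m ε ≤ ENNReal.ofReal δ ∧
      ENNReal.ofReal (21 * (1 + m) * δ) = ENNReal.ofReal (21 * (1 + m) * δ₁) := by
    refine ⟨max δ₁ 0, le_max_right _ _, max_le hδ₁ (by norm_num), ?_, ?_⟩
    · exact hH.trans (ENNReal.ofReal_le_ofReal (le_max_left _ _))
    · have hK : 0 ≤ 21 * (1 + (m:ℝ)) := by positivity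
      rw [ENNReal.ofReal_mul hK, ENNReal.ofReal_mul hK, ENNReal.ofReal_max,
        ENNReal.ofReal_zero, max_eq_left zero_le]
  rw [← hgoal]
  have hd : ∀ r ∈ Ioi (0:ℝ), HasDerivAt ε (deriv ε r) r := fun r hr =>
    ((hC1.differentiableOn one_ne_zero).differentiableAt (Ioi_mem_nhds hr)).hasDerivAt
  have hc : ContinuousOn ε (Ioi 0) := hC1.continuousOn
  have hm : AEStronglyMeasurable ε (volume.restrict (Ioi (0:ℝ))) :=
    hc.aestronglyMeasurable measurableSet_Ioi
  have hdm : AEStronglyMeasurable (deriv ε) (volume.restrict (Ioi (0:ℝ))) :=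
    (measurable_deriv ε).aestronglyMeasurable
  have hqm : AEStronglyMeasurable (fun r => ε r / (Real.sinh r : ℂ))
      (volume.restrict (Ioi (0:ℝ))) := by
    refine (hc.div (by fun_prop) fun r hr => ?_).aestronglyMeasurable measurableSet_Ioi
    exact_mod_cast (Real.sinh_pos_iff.2 hr).ne'
  obtain ⟨hi', hX⟩ := setIntegral_le_of_wLp_two_le hδ hdm (le_self_add.trans hH)
  obtain ⟨hiq, hY⟩ := setIntegral_le_of_wLp_two_le hδ hqm (le_add_self.trans hH)
  have hi := integrableOn_of_wLp_two_lt_top hm hL2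
  have hP := setIntegral_sq_mul_sinh_le hd hdm h0 hi hi'
  have hε1 : ∀ r ∈ Ioi (0:ℝ), ‖ε r‖ ≤ 1 := by
    intro r hr
    have h := sq_norm_le_of_weighted_bounds hd hdm h0 hiq hi' hr
    nlinarith [norm_nonneg (ε r)]
  obtain ⟨hiG, hZ⟩ := setIntegral_sq_primitive_div_sinh_le hc.norm
    (fun r _ => norm_nonneg _) hε1 hi
  have hI1 := (hi'.const_mul 3).add (hiq.const_mul (3 * (m:ℝ) ^ 2))
  refine wLp_two_le_of_sq_le (by positivity) (hI1.add (hiG.const_mul 27)) (fun r hr => ?_) ?_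
  · have hs : 0 < Real.sinh r := Real.sinh_pos_iff.2 hr
    have h := norm_eps1_le hQ0 hQ1 hA hc hε1 hr
    simp only [Pi.add_apply]
    set a := ‖deriv ε r‖
    set b := ‖ε r / (Real.sinh r : ℂ)‖
    set G := ∫ s in Ioc 0 r, ‖ε s‖ * Real.sinh s
    calc _ ≤ (a + m * b + 3 * (G / Real.sinh r)) ^ 2 * Real.sinh r := by gcongr
      _ ≤ (3 * a ^ 2 + 3 * (m * b) ^ 2 + 3 * (3 * (G / Real.sinh r)) ^ 2) * Real.sinh r := by
        gcongr
        nlinarith [sq_nonneg (a - m * b), sq_nonneg (a - 3 * (G / Real.sinh r)),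
          sq_nonneg (m * b - 3 * (G / Real.sinh r))]
      _ = _ := by
        field_simp
        ring
  · rw [integral_add' hI1 (hiG.const_mul 27), integral_add' (hi'.const_mul 3) (hiq.const_mul _),
      integral_const_mul, integral_const_mul, integral_const_mul]
    have hmY := mul_le_mul_of_nonneg_left hY (by positivity : 0 ≤ 3 * (m:ℝ) ^ 2)
    have hmδ : 0 ≤ (m:ℝ) * δ ^ 2 := by positivity
    have hmδ2 : 0 ≤ (m:ℝ) ^ 2 * δ ^ 2 := by positivity
    nlinarith


end
end
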